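/- Let 𝔽 be an algebraically closed field of characteristic zero. Let A ⊆ T(V) be a graded, contraction-closed subalgebra containing the tensor Σ_{i=1}^n e_i ⊗ e_i. Suppose the pointwise stabilizer Stab(A) := ∩_{a∈A} Stab(a) equals Stab(w) for some w ∈ A (lying in a finite direct sum of graded pieces) whose O_n-orbit is Zariski-closed. Then A = T(V)^{Stab(A)}, the algebra of all Stab(A)-invariant tensors, and moreover Stab(A) is a reductive algebraic group. -/

import Mathlib

/-!
Formalization framework for "Partition functions of vertex models /
edge connection matrices" (Regts–Draisma style).

Graphs and fragments are finite multigraphs (allowing multiple edges, loops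
and circles); a `k`-fragment additionally has `k` labelled open ends.  We
encode a `k`-fragment by a number `nv` of internal vertices, a number `ne`
of edges, and for each edge the multiset of its endpoints, each endpoint
being either an internal vertex (`Sum.inl`) or an open-end label
(`Sum.inr`).  Every edge has `2` endpoints (counted with multiplicity; a
loop at `v` lists `v` twice) or `0` endpoints (a circle), and every label
occurs exactly once in total (the open ends have degree one).
-/

open MvPolynomial

namespace VertexModels

noncomputable section

/-- A `k`-fragment. For `k = 0` this is a graph. -/
structure Fragment (k : ℕ) : Type where
  nv : ℕ
  ne : ℕ
  inc : Fin ne → Multiset (Fin nv ⊕ Fin k)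
  card_inc : ∀ e, Multiset.card (inc e) = 2 ∨ Multiset.card (inc e) = 0
  openEnd : ∀ j : Fin k, (∑ e, (inc e).count (Sum.inr j)) = 1

/-- A graph: a `0`-fragment. -/
abbrev Graph := Fragment 0

/-- The basic `k`-fragment `F_k`: one internal vertex joined to each of the
`k` open ends by a half edge. -/
def basicFragment (k : ℕ) : Fragment k where
  nv := 1
  ne := k
  inc := fun e => {Sum.inl 0, Sum.inr e}
  card_inc := fun e => Or.inl (by simp)
  openEnd := fun j => by
    have h : ∀ e : Fin k,
        Multiset.count (Sum.inr j) ({Sum.inl 0, Sum.inr e} : Multiset (Fin 1 ⊕ Fin k))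
          = if j = e then 1 else 0 := by
      intro e
      by_cases he : j = e <;>
        simp [Multiset.count_cons, Multiset.count_singleton, he]
    simp only [h]
    simp

variable {𝔽 : Type} [Field 𝔽] {n : ℕ}

/-- A vertex model: a linear functional on `R = 𝔽[x_1, …, x_n]`. -/
abbrev VertexModel (𝔽 : Type) [Field 𝔽] (n : ℕ) : Type :=
  MvPolynomial (Fin n) 𝔽 →ₗ[𝔽] 𝔽

/-- The monomial `∏_{e ∈ δ(v)} x_{ψ(e)}` seen by the internal vertex `v` of a
fragment under the edge colouring `ψ`. -/
def monomialAt {k : ℕ} (F : Fragment k) (ψ : Fin F.ne → Fin n) (v : Fin F.nv) :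
    MvPolynomial (Fin n) 𝔽 :=
  ∏ e, (X (ψ e) : MvPolynomial (Fin n) 𝔽) ^ ((F.inc e).count (Sum.inl v))

/-- The partition function `f_h` of the vertex model `h`. -/
def partitionFun (h : VertexModel 𝔽 n) (G : Graph) : 𝔽 :=
  ∑ ψ : Fin G.ne → Fin n, ∏ v, h (monomialAt G ψ v)

/-- `h_φ(F)`, for a `k`-fragment `F` and a colouring `φ` of the open ends. -/
def hphi (h : VertexModel 𝔽 n) {k : ℕ} (F : Fragment k) (φ : Fin k → Fin n) : 𝔽 :=
  ∑ ψ ∈ Finset.univ.filter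
      (fun ψ : Fin F.ne → Fin n => ∀ (e : Fin F.ne) (j : Fin k),
        Sum.inr j ∈ F.inc e → ψ e = φ j),
    ∏ v, h (monomialAt F ψ v)

/-- `V^{⊗ k}` in coordinates: functions on multi-indices, with basis
`e_φ`. -/
abbrev Tensor (𝔽 : Type) [Field 𝔽] (n k : ℕ) : Type := (Fin k → Fin n) → 𝔽

/-- The tensor `p_h(F) = ∑_φ h_φ(F) e_φ ∈ V^{⊗ k}`. -/
def ph (h : VertexModel 𝔽 n) {k : ℕ} (F : Fragment k) : Tensor 𝔽 n k :=
  fun φ => hphi h F φ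

/-- The standard bilinear form on `V^{⊗ k}`. -/
def tpair {k : ℕ} (t s : Tensor 𝔽 n k) : 𝔽 := ∑ φ, t φ * s φ

/-- Tensor product `V^{⊗ k} × V^{⊗ l} → V^{⊗ (k+l)}`. -/
def tmul {k l : ℕ} (t : Tensor 𝔽 n k) (s : Tensor 𝔽 n l) : Tensor 𝔽 n (k + l) :=
  fun φ => t (fun i => φ (Fin.castAdd l i)) * s (fun i => φ (Fin.natAdd k i))

/-- The contraction `C^k_{i,j} : V^{⊗ k} → V^{⊗ (k-2)}` (here `k = m + 2`),
contracting the `i`-th and `j`-th tensor factors (`i < j`). -/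
def tcontract {m : ℕ} (i j : Fin (m + 2)) (t : Tensor 𝔽 n (m + 2)) : Tensor 𝔽 n m :=
  fun φ => ∑ c : Fin n,
    t (Fin.insertNth i c (Fin.insertNth (⟨j.1 - 1, by have := j.isLt; omega⟩ : Fin (m + 1)) c φ))

/-- The orthogonal group `O_n`, as the set of matrices `g` with `gᵀ g = 1`. -/
def orthSet (𝔽 : Type) [Field 𝔽] (n : ℕ) : Set (Matrix (Fin n) (Fin n) 𝔽) :=
  {g | g.transpose * g = 1}

/-- Substitution `X i ↦ ∑ j, g i j • X j`, i.e. composition of a polynomial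
with the linear map `g`, as a linear endomorphism of `R`. -/
noncomputable def polSub (g : Matrix (Fin n) (Fin n) 𝔽) :
    MvPolynomial (Fin n) 𝔽 →ₗ[𝔽] MvPolynomial (Fin n) 𝔽 :=
  (MvPolynomial.aeval (fun i => ∑ j, MvPolynomial.C (g i j) * X j)).toLinearMap

/-- The action of `g ∈ O_n` on vertex models: `(g h)(p) = h (p ∘ g) = h(g⁻¹ • p)`. -/
noncomputable def dualAct (g : Matrix (Fin n) (Fin n) 𝔽) (h : VertexModel 𝔽 n) :
    VertexModel 𝔽 n :=
  h.comp (polSub g)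

/-- The stabilizer `Stab(h) = {g ∈ O_n ∣ g h = h}`. -/
noncomputable def Stab (h : VertexModel 𝔽 n) : Set (Matrix (Fin n) (Fin n) 𝔽) :=
  {g | g ∈ orthSet 𝔽 n ∧ dualAct g h = h}

/-- The diagonal action of a matrix `g` on `V^{⊗ k}`. -/
def tact (g : Matrix (Fin n) (Fin n) 𝔽) (k : ℕ) :
    Tensor 𝔽 n k →ₗ[𝔽] Tensor 𝔽 n k :=
  Matrix.mulVecLin (Matrix.of fun φ ψ : Fin k → Fin n => ∏ i, g (φ i) (ψ i))

/-- The subspace `(V^{⊗ k})^S` of tensors fixed by every element of a set `S`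
of matrices. -/
def invSub (S : Set (Matrix (Fin n) (Fin n) 𝔽)) (k : ℕ) :
    Submodule 𝔽 (Tensor 𝔽 n k) where
  carrier := {t | ∀ g ∈ S, tact g k t = t}
  add_mem' := fun {a b} ha hb => by
    intro g hg
    rw [map_add, ha g hg, hb g hg]
  zero_mem' := by
    intro g hg
    rw [map_zero]
  smul_mem' := fun c a ha => by
    intro g hg
    rw [map_smul, ha g hg]

/-! ### Gluing two `k`-fragments into a graph -/

/-- `touches F H j a`: the edge `a` of the disjoint union of `F` and `H` is
incident with the open end labelled `j` (of its own fragment). -/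
def touches {k : ℕ} (F H : Fragment k) (j : Fin k) : Fin F.ne ⊕ Fin H.ne → Prop
  | .inl e => Sum.inr j ∈ F.inc e
  | .inr e => Sum.inr j ∈ H.inc e

/-- Edges of `F` and `H` which get merged into a single edge of `F * H` are
identified by the equivalence generated by sharing an open-end label. -/
def glueSetoid {k : ℕ} (F H : Fragment k) : Setoid (Fin F.ne ⊕ Fin H.ne) :=
  Relation.EqvGen.setoid (fun a b => ∃ j, touches F H j a ∧ touches F H j b)

/-- Number of edges of the glued graph `F * H`. -/
noncomputable def glueNE {k : ℕ} (F H : Fragment k) : ℕ :=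
  Nat.card (Quotient (glueSetoid F H))

noncomputable def glueEquiv {k : ℕ} (F H : Fragment k) :
    Fin (glueNE F H) ≃ Quotient (glueSetoid F H) :=
  (Finite.equivFin _).symm

/-- The internal (non-open-end) endpoints of an edge of the disjoint union,
re-indexed in `Fin (F.nv + H.nv)`. -/
def intEnds {k : ℕ} (F H : Fragment k) :
    Fin F.ne ⊕ Fin H.ne → Multiset (Fin (F.nv + H.nv) ⊕ Fin 0)
  | .inl e => (F.inc e).filterMap fun x =>
      match x with
      | .inl v => some (Sum.inl (Fin.castAdd H.nv v))
      | .inr _ => none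
  | .inr e => (H.inc e).filterMap fun x =>
      match x with
      | .inl v => some (Sum.inl (Fin.natAdd F.nv v))
      | .inr _ => none

/-- Endpoints of an edge of the glued graph: the internal endpoints of all
edges merged into it. -/
noncomputable def glueInc {k : ℕ} (F H : Fragment k) (c : Fin (glueNE F H)) :
    Multiset (Fin (F.nv + H.nv) ⊕ Fin 0) := by
  classical
  exact ∑ a ∈ Finset.univ.filter
    (fun a => Quotient.mk (glueSetoid F H) a = glueEquiv F H c), intEnds F H a

/-- The glued graph `F * H` of two `k`-fragments: connect the half edges
with equally labelled open ends into single edges (chains of half edges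
closing up produce circles).  (The impossible degenerate branch is never
taken.) -/
noncomputable def glue {k : ℕ} (F H : Fragment k) : Graph := by
  classical
  exact if hc : ∀ c, Multiset.card (glueInc F H c) = 2 ∨ Multiset.card (glueInc F H c) = 0 then
    { nv := F.nv + H.nv
      ne := glueNE F H
      inc := glueInc F H
      card_inc := hc
      openEnd := fun j => j.elim0 }
  else basicFragment 0

/-- The rank of the edge connection matrix `M_{f_h,k}` : the dimension of the
span of its rows. -/
noncomputable def connectionRank (h : VertexModel 𝔽 n) (k : ℕ) : ℕ :=
  Module.finrank 𝔽 (Submodule.span 𝔽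
    (Set.range fun F : Fragment k => fun H : Fragment k => partitionFun h (glue F H)))

/-! ### The algebra `𝒜` of formal linear combinations of fragments -/

/-- `p_h` on formal linear combinations `𝔽ℱ_k` of `k`-fragments. -/
noncomputable def phL (h : VertexModel 𝔽 n) (k : ℕ) :
    (Fragment k →₀ 𝔽) →ₗ[𝔽] Tensor 𝔽 n k :=
  Finsupp.linearCombination 𝔽 (fun F : Fragment k => ph h F)

/-- `γ ↦ (F ↦ f_h(γ * F))`: the bilinear extension of gluing followed by the
partition function.  Its kernel is `I_k`. -/
noncomputable def glueRow (h : VertexModel 𝔽 n) (k : ℕ) :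
    (Fragment k →₀ 𝔽) →ₗ[𝔽] (Fragment k → 𝔽) :=
  Finsupp.linearCombination 𝔽
    (fun F : Fragment k => fun H : Fragment k => partitionFun h (glue F H))

/-- A vertex model is nondegenerate if `ker p_h = I`. -/
def Nondeg (h : VertexModel 𝔽 n) : Prop :=
  ∀ (k : ℕ) (γ : Fragment k →₀ 𝔽), phL h k γ = 0 ↔ glueRow h k γ = 0

/-! ### The product of fragments and the contraction of fragments -/

/-- Endpoint multisets of the disjoint union `F H` of fragments (`H`'s open
ends relabelled by `i ↦ k + i`). -/
def mulInc {k l : ℕ} (F : Fragment k) (H : Fragment l) :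
    Fin (F.ne + H.ne) → Multiset (Fin (F.nv + H.nv) ⊕ Fin (k + l)) :=
  Fin.addCases
    (fun e => (F.inc e).map (Sum.map (Fin.castAdd H.nv) (Fin.castAdd l)))
    (fun e => (H.inc e).map (Sum.map (Fin.natAdd F.nv) (Fin.natAdd k)))

/-- The product `F H` in the fragment algebra `𝒜`: disjoint union, with the
open ends of `H` relabelled `i ↦ k + i`.  (The impossible degenerate branch
is never taken.) -/
noncomputable def fragMul {k l : ℕ} (F : Fragment k) (H : Fragment l) :
    Fragment (k + l) := by
  classical
  exact if hc : (∀ e, Multiset.card (mulInc F H e) = 2 ∨ Multiset.card (mulInc F H e) = 0)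
      ∧ (∀ j : Fin (k + l), (∑ e, (mulInc F H e).count (Sum.inr j)) = 1) then
    { nv := F.nv + H.nv
      ne := F.ne + H.ne
      inc := mulInc F H
      card_inc := hc.1
      openEnd := hc.2 }
  else basicFragment (k + l)

/-- Relabelling map for labels after removing labels `i` and `j` (`i < j`),
preserving the order of the remaining labels. -/
def downLabel {m : ℕ} (i j l : Fin (m + 2)) (hij : i < j) (h : ¬(l = i ∨ l = j)) : Fin m :=
  ⟨l.1 - (if i.1 < l.1 then 1 else 0) - (if j.1 < l.1 then 1 else 0), by
    push_neg at h
    have h1 : l.1 ≠ i.1 := fun hh => h.1 (Fin.ext hh)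
    have h2 : l.1 ≠ j.1 := fun hh => h.2 (Fin.ext hh)
    have h3 : i.1 < j.1 := hij
    have h4 := l.isLt
    have h6 := j.isLt
    split_ifs <;> omega⟩

/-- Removing the open ends `i` and `j` from an endpoint multiset and
relabelling the remaining open ends. -/
def removeEnd {m nv : ℕ} (i j : Fin (m + 2)) (hij : i < j) :
    Fin nv ⊕ Fin (m + 2) → Option (Fin nv ⊕ Fin m)
  | .inl v => some (.inl v)
  | .inr l => if h : l = i ∨ l = j then none else some (.inr (downLabel i j l hij h))

/-- Edges merged by the contraction `Γ^k_{i,j}`: those incident with the open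
end `i` or the open end `j`. -/
def contractSetoid {m : ℕ} (F : Fragment (m + 2)) (i j : Fin (m + 2)) :
    Setoid (Fin F.ne) :=
  Relation.EqvGen.setoid (fun e e' =>
    (Sum.inr i ∈ F.inc e ∨ Sum.inr j ∈ F.inc e) ∧
    (Sum.inr i ∈ F.inc e' ∨ Sum.inr j ∈ F.inc e'))

noncomputable def contractNE {m : ℕ} (F : Fragment (m + 2)) (i j : Fin (m + 2)) : ℕ :=
  Nat.card (Quotient (contractSetoid F i j))

noncomputable def contractEquiv {m : ℕ} (F : Fragment (m + 2)) (i j : Fin (m + 2)) :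
    Fin (contractNE F i j) ≃ Quotient (contractSetoid F i j) :=
  (Finite.equivFin _).symm

noncomputable def contractInc {m : ℕ} (F : Fragment (m + 2)) (i j : Fin (m + 2))
    (hij : i < j) (c : Fin (contractNE F i j)) : Multiset (Fin F.nv ⊕ Fin m) := by
  classical
  exact ∑ e ∈ Finset.univ.filter
    (fun e => Quotient.mk (contractSetoid F i j) e = contractEquiv F i j c),
    (F.inc e).filterMap (removeEnd i j hij)

/-- The contraction `Γ^k_{i,j}(F)` of a `(m+2)`-fragment: join the half edges
at the open ends labelled `i` and `j` into a single edge (possibly a circle)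
and relabel the remaining open ends preserving their order.  (The impossible
degenerate branch is never taken.) -/
noncomputable def fragContract {m : ℕ} (i j : Fin (m + 2)) (hij : i < j)
    (F : Fragment (m + 2)) : Fragment m := by
  classical
  exact if hc : (∀ c, Multiset.card (contractInc F i j hij c) = 2 ∨
        Multiset.card (contractInc F i j hij c) = 0)
      ∧ (∀ jj : Fin m, (∑ c, (contractInc F i j hij c).count (Sum.inr jj)) = 1) then
    { nv := F.nv
      ne := contractNE F i j
      inc := contractInc F i j hij
      card_inc := hc.1
      openEnd := hc.2 }
  else basicFragment m

/-! ### Zariski closedness, spin models, reductivity -/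

/-- A subset of a coordinate space `ι → 𝔽` is Zariski closed if it is the
common zero locus of a set of polynomials. -/
def IsZarClosed {ι : Type} (S : Set (ι → 𝔽)) : Prop :=
  ∃ P : Set (MvPolynomial ι 𝔽), S = {x | ∀ p ∈ P, MvPolynomial.eval x p = 0}

/-- The vertex model `h(p) = ∑ i, a i • p (u i)` attached to points
`u_1, …, u_m` and coefficients `a_1, …, a_m`. -/
noncomputable def spinModel {m : ℕ} (u : Fin m → (Fin n → 𝔽)) (a : Fin m → 𝔽) :
    VertexModel 𝔽 n :=
  ∑ i, a i • (MvPolynomial.aeval (u i) : MvPolynomial (Fin n) 𝔽 →ₐ[𝔽] 𝔽).toLinearMap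

/-- Multi-degrees of total degree at most `e`: coordinates for the space
`(R_{≤ e})^*`. -/
def LowDeg (n e : ℕ) : Type := {d : Fin n →₀ ℕ // (d.sum fun _ c => c) ≤ e}

/-- The `O_n`-orbit of `h_e` (the restriction of `h` to polynomials of degree
at most `e`), in coordinates. -/
noncomputable def restOrbit (h : VertexModel 𝔽 n) (e : ℕ) : Set (LowDeg n e → 𝔽) :=
  {y | ∃ g ∈ orthSet 𝔽 n, ∀ d : LowDeg n e,
    y d = dualAct g h (MvPolynomial.monomial d.1 (1 : 𝔽))}

/-- The `O_n`-orbit of an `m`-tuple of vectors, in coordinates. -/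
def vecOrbit {m : ℕ} (u : Fin m → (Fin n → 𝔽)) : Set (Fin m × Fin n → 𝔽) :=
  {y | ∃ g ∈ orthSet 𝔽 n, ∀ p : Fin m × Fin n, y p = g.mulVec (u p.1) p.2}

/-- The `O_n`-orbit of an element `w` of `⊕_{k ≤ e} V^{⊗ k}`, in
coordinates. -/
def tensorTupleOrbit (e : ℕ) (w : ∀ k : ℕ, Tensor 𝔽 n k) :
    Set ((Σ p : Fin (e + 1), (Fin p.1 → Fin n)) → 𝔽) :=
  {y | ∃ g ∈ orthSet 𝔽 n, ∀ q : Σ p : Fin (e + 1), (Fin p.1 → Fin n),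
    y q = tact g q.1 (w q.1) q.2}

/-- Linear reductivity of a set `H` of `n × n` matrices: in every
polynomial representation of `H`, every `H`-invariant subspace admits an
`H`-invariant complement. -/
def IsLinRed (H : Set (Matrix (Fin n) (Fin n) 𝔽)) : Prop :=
  ∀ (m : ℕ) (ρ : Matrix (Fin n) (Fin n) 𝔽 → Matrix (Fin m) (Fin m) 𝔽),
    (∀ a b : Fin m, ∃ p : MvPolynomial (Fin n × Fin n) 𝔽,
      ∀ g, ρ g a b = MvPolynomial.eval (fun q => g q.1 q.2) p) →
    (∀ g ∈ H, ∀ g' ∈ H, ρ (g * g') = ρ g * ρ g') → ρ 1 = 1 →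
    ∀ W : Submodule 𝔽 (Fin m → 𝔽),
      (∀ g ∈ H, ∀ w ∈ W, (ρ g).mulVec w ∈ W) →
      ∃ W' : Submodule 𝔽 (Fin m → 𝔽), IsCompl W W' ∧
        (∀ g ∈ H, ∀ w ∈ W', (ρ g).mulVec w ∈ W')

/-- The pointwise stabilizer in `O_n` of a graded family of subspaces of the
tensor algebra. -/
def setStab (A : ∀ k : ℕ, Submodule 𝔽 (Tensor 𝔽 n k)) :
    Set (Matrix (Fin n) (Fin n) 𝔽) :=
  {g | g ∈ orthSet 𝔽 n ∧ ∀ (k : ℕ), ∀ a ∈ A k, tact g k a = a}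

/-- The sum of the nontrivial `H`-isotypic components of `V^{⊗ k}`: the
largest `H`-stable subspace meeting the invariants trivially. -/
def nontrivialPart (H : Set (Matrix (Fin n) (Fin n) 𝔽)) (k : ℕ) :
    Submodule 𝔽 (Tensor 𝔽 n k) :=
  sSup {W | (∀ g ∈ H, ∀ w ∈ W, tact g k w ∈ W) ∧ W ⊓ invSub H k = ⊥}

end

end VertexModels

open VertexModels

section IntegralFunctional

open TensorProduct

/-- A finite separable extension stays reduced after base change to a reduced algebra. -/
theorem isReduced_tensorProduct_of_isSeparable {K B L : Type} [Field K] [CommRing B] [Algebra K B]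
    [IsReduced B] [Field L] [Algebra K L] [FiniteDimensional K L] [Algebra.IsSeparable K L] :
    IsReduced (B ⊗[K] L) := by
  constructor
  intro x hx
  let b := Module.finBasis K L
  apply (Algebra.TensorProduct.basis B b).repr.injective
  rw [map_zero]
  ext i
  rw [Finsupp.zero_apply]
  apply IsNilpotent.eq_zero
  rw [← mem_nilradical, nilradical, Ideal.radical_eq_sInf, Ideal.mem_sInf]
  rintro q ⟨-, hq⟩
  have : Algebra.FormallyUnramified K L := Algebra.FormallyUnramified.of_isSeparable K L
  have : IsReduced (q.ResidueField ⊗[K] L) :=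
    Algebra.FormallyUnramified.isReduced_of_field q.ResidueField (q.ResidueField ⊗[K] L)
  let f : B →ₐ[K] q.ResidueField := IsScalarTower.toAlgHom K B q.ResidueField
  have key : ∀ y : B ⊗[K] L,
      (Algebra.TensorProduct.basis q.ResidueField b).repr
        (Algebra.TensorProduct.map f (AlgHom.id K L) y) i =
      f ((Algebra.TensorProduct.basis B b).repr y i) := by
    intro y
    induction y with
    | zero => simp
    | tmul a l => simp [f, Algebra.smul_def, ← IsScalarTower.algebraMap_apply K B q.ResidueField]
    | add y z hy hz => simp only [map_add, Finsupp.add_apply, hy, hz]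
  have h0 : Algebra.TensorProduct.map f (AlgHom.id K L) x = 0 := (hx.map _).eq_zero
  have h1 := key x
  rw [h0, map_zero, Finsupp.zero_apply] at h1
  exact Ideal.algebraMap_residueField_eq_zero.mp h1.symm

/-- A nontrivial reduced algebra of finite type over a field of characteristic zero has a normalized
linear functional whose base change along any reduced algebra kills nilpotents. -/
theorem exists_functional_rTensor_eq_zero_of_isNilpotent {K R : Type} [Field K] [CharZero K]
    [CommRing R] [Algebra K R] [Algebra.FiniteType K R] [IsReduced R] [Nontrivial R] :
    ∃ ℓ : R →ₗ[K] K, ℓ 1 = 1 ∧ ∀ x : R ⊗[K] R, IsNilpotent x → ℓ.lTensor R x = 0 := by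
  obtain ⟨m, hm⟩ := Ideal.exists_maximal R
  let _ : Field (R ⧸ m) := Ideal.Quotient.field m
  have : Module.Finite K (R ⧸ m) := finite_of_finite_type_of_isJacobsonRing K (R ⧸ m)
  let d : K := Module.finrank K (R ⧸ m)
  have hd : d ≠ 0 := Nat.cast_ne_zero.mpr Module.finrank_pos.ne'
  let θ : R →ₐ[K] R ⧸ m := Ideal.Quotient.mkₐ K m
  refine ⟨d⁻¹ • (Algebra.trace K (R ⧸ m)) ∘ₗ θ.toLinearMap, ?_, fun x hx => ?_⟩
  · have h := Algebra.trace_algebraMap (R := K) (S := R ⧸ m) 1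
    rw [map_one] at h
    simp [h, d, inv_mul_cancel₀ hd, nsmul_eq_mul]
  · have : IsReduced (R ⊗[K] (R ⧸ m)) := isReduced_tensorProduct_of_isSeparable
    have h0 : Algebra.TensorProduct.map (AlgHom.id K R) θ x = 0 := (hx.map _).eq_zero
    have h1 : θ.toLinearMap.lTensor R x = 0 := h0
    rw [← LinearMap.smul_comp, LinearMap.lTensor_comp, LinearMap.comp_apply, h1, map_zero]

theorem isField_localization_of_mem_minimalPrimes {S : Type} [CommRing S] [IsReduced S]
    {p : Ideal S} [p.IsPrime] (hp : p ∈ minimalPrimes S) : IsField (Localization.AtPrime p) := by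
  have := Ring.KrullDimLE.of_isLocalization p hp (Localization.AtPrime p)
  have : IsReduced (Localization.AtPrime p) :=
    isReduced_localizationPreserves p.primeCompl _ ‹_›
  exact Ring.KrullDimLE.isField_of_isReduced

theorem exists_functional_lTensor_eq_zero_of_isNilpotent {S K R : Type} [CommRing S] [Field K]
    [CharZero K] [Algebra S K] [CommRing R] [Algebra S R] [Algebra.FiniteType S R]
    [IsReduced (K ⊗[S] R)] [Nontrivial (K ⊗[S] R)] :
    ∃ ℓ : R →ₗ[S] K, ℓ 1 = 1 ∧ ∀ z : R ⊗[S] R, IsNilpotent z → ℓ.lTensor R z = 0 := by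
  obtain ⟨ℓ, h1, h2⟩ := exists_functional_rTensor_eq_zero_of_isNilpotent (K := K) (R := K ⊗[S] R)
  refine ⟨(ℓ.restrictScalars S).comp (TensorProduct.mk S K R 1), h1, fun z hz => ?_⟩
  let i : R →ₐ[S] K ⊗[S] R := Algebra.TensorProduct.includeRight
  let i₁ : R →ₐ[S] (K ⊗[S] R) ⊗[K] (K ⊗[S] R) :=
    ((Algebra.TensorProduct.includeLeft : (K ⊗[S] R) →ₐ[K] (K ⊗[S] R) ⊗[K] (K ⊗[S] R))
      |>.restrictScalars S).comp i
  let i₂ : R →ₐ[S] (K ⊗[S] R) ⊗[K] (K ⊗[S] R) :=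
    ((Algebra.TensorProduct.includeRight : (K ⊗[S] R) →ₐ[K] (K ⊗[S] R) ⊗[K] (K ⊗[S] R))
      |>.restrictScalars S).comp i
  let f : R ⊗[S] R →ₐ[S] (K ⊗[S] R) ⊗[K] (K ⊗[S] R) :=
    Algebra.TensorProduct.lift i₁ i₂ fun a b => Commute.all (i₁ a) (i₂ b)
  have key : ∀ z : R ⊗[S] R,
      TensorProduct.comm S R K (((ℓ.restrictScalars S).comp (TensorProduct.mk S K R 1)).lTensor R z)
        = TensorProduct.rid K (K ⊗[S] R) (ℓ.lTensor _ (f z)) := by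
    intro z
    induction z with
    | zero => simp
    | tmul a l => simp [f, i, i₁, i₂, TensorProduct.smul_tmul']
    | add y z hy hz => simp only [map_add, hy, hz]
  have h3 := h2 _ (hz.map f)
  have h4 := key z
  rw [h3, map_zero] at h4
  exact (TensorProduct.comm S R K).injective (h4.trans (map_zero _).symm)

/-- Over some generic point `p` of the base, a reduced algebra of finite type carries a normalized
functional killing the nilpotents of the tensor square. -/
theorem exists_prime_functional_lTensor_eq_zero {F S R : Type} [Field F] [CharZero F] [CommRing S]
    [CommRing R] [Algebra F S] [Algebra S R] (hinj : Function.Injective (algebraMap S R))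
    [Algebra.FiniteType S R] [IsReduced R] [Nontrivial R] :
    ∃ (p : Ideal S) (_ : p.IsPrime) (ℓ : R →ₗ[S] Localization.AtPrime p), ℓ 1 = 1 ∧
      ∀ z : R ⊗[S] R, IsNilpotent z → ℓ.lTensor R z = 0 := by
  have : IsReduced S := isReduced_of_injective (algebraMap S R) hinj
  have : Nontrivial S := (algebraMap S R).domain_nontrivial
  obtain ⟨p, hp⟩ := Ideal.nonempty_minimalPrimes (I := (⊥ : Ideal S)) bot_ne_top
  have hpp : p.IsPrime := hp.1.1
  have : CharZero (Localization.AtPrime p) :=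
    charZero_of_injective_algebraMap (algebraMap F (Localization.AtPrime p)).injective
  have : IsReduced (R ⊗[S] Localization.AtPrime p) :=
    isReduced_localizationPreserves (Algebra.algebraMapSubmonoid R p.primeCompl) _ ‹_›
  have : IsReduced (Localization.AtPrime p ⊗[S] R) :=
    isReduced_of_injective (Algebra.TensorProduct.comm S (Localization.AtPrime p) R)
      (AlgEquiv.injective _)
  have : Nontrivial (Localization.AtPrime p ⊗[S] R) := by
    have hK : Function.Injective ((Algebra.linearMap S R).lTensor (Localization.AtPrime p)) :=
      Module.Flat.lTensor_preserves_injective_linearMap _ hinj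
    refine ⟨0, 1, fun h => one_ne_zero (α := Localization.AtPrime p) ?_⟩
    have h1 : (1 : Localization.AtPrime p) ⊗ₜ[S] (1 : S) = 0 :=
      hK (by simpa [Algebra.TensorProduct.one_def] using h.symm)
    simpa using congrArg (TensorProduct.rid S (Localization.AtPrime p)) h1
  let _ : Field (Localization.AtPrime p) := (isField_localization_of_mem_minimalPrimes hp).toField
  exact ⟨p, hpp, exists_functional_lTensor_eq_zero_of_isNilpotent⟩

end IntegralFunctional

section Denominators

open TensorProduct

variable {S R : Type} [CommRing S] [CommRing R] [Algebra S R] (p : Ideal S) [p.IsPrime]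

theorem exists_smul_eq_zero_of_tmul_one_eq_zero [IsNoetherianRing R] :
    ∃ s ∉ p, ∀ r : R, r ⊗ₜ[S] (1 : Localization.AtPrime p) = 0 → s • r = 0 := by
  classical
  let M := Algebra.algebraMapSubmonoid R p.primeCompl
  obtain ⟨T, hT⟩ := IsNoetherian.noetherian
    (RingHom.ker (algebraMap R (R ⊗[S] Localization.AtPrime p)))
  have h1 : ∀ r : R, r ∈ RingHom.ker (algebraMap R (R ⊗[S] Localization.AtPrime p)) →
      ∃ s ∉ p, s • r = 0 := by
    intro r hr
    obtain ⟨⟨_, s, hs, rfl⟩, hm⟩ := (IsLocalization.map_eq_zero_iff M _ r).mp hr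
    exact ⟨s, hs, by rw [Algebra.smul_def]; exact hm⟩
  have h2 : ∀ r ∈ T, ∃ s ∉ p, s • r = 0 := fun r hr =>
    h1 r (hT ▸ Submodule.subset_span hr)
  choose! s hs1 hs2 using h2
  refine ⟨∏ r ∈ T, s r, ?_, fun r hr => ?_⟩
  · rw [Ideal.IsPrime.prod_mem_iff]
    push Not
    exact hs1
  · have hr' : r ∈ Submodule.span R (T : Set R) := hT ▸ (show r ∈ RingHom.ker _ from hr)
    clear hr
    induction hr' using Submodule.span_induction with
    | mem x hx =>
      rw [← Finset.prod_erase_mul _ _ hx, mul_smul, hs2 x hx, smul_zero]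
    | zero => simp
    | add x y hx hy h h' =>
      rw [smul_add, h, h', add_zero]
    | smul a x hx h =>
      rw [smul_comm, h, smul_zero]

theorem exists_smul_eq_tmul_one {ι : Type} [Finite ι] (u : ι → R ⊗[S] Localization.AtPrime p) :
    ∃ s ∉ p, ∀ i, ∃ r : R, s • u i = r ⊗ₜ 1 := by
  obtain ⟨⟨_, s, hs, rfl⟩, h⟩ := IsLocalization.exist_integer_multiples_of_finite
    (Algebra.algebraMapSubmonoid R p.primeCompl) u
  refine ⟨s, hs, fun i => ?_⟩
  obtain ⟨r, hr⟩ := h i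
  refine ⟨r, ?_⟩
  rw [← algebraMap_smul R s]
  exact hr.symm

end Denominators

open MvPolynomial VertexModels
section Cayley

open Matrix

/-- The denominators of a polynomial evaluated at fractions `u i / d` can be cleared universally. -/
theorem exists_homogenization {σ F : Type} [Field F] (f : MvPolynomial σ F) :
    ∃ (N : ℕ) (f' : MvPolynomial (Option σ) F), ∀ (C : Type) [CommRing C] [Algebra F C]
      (v u : σ → C) (d : C), (∀ i, v i * d = u i) →
        aeval (fun o : Option σ => o.elim d u) f' = d ^ N * aeval v f := by
  induction f using MvPolynomial.induction_on with
  | C a => exact ⟨0, C a, fun C _ _ v u d h => by simp⟩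
  | add p q hp hq =>
    obtain ⟨N, p', hp⟩ := hp
    obtain ⟨M, q', hq⟩ := hq
    refine ⟨N + M, X none ^ M * p' + X none ^ N * q', fun C _ _ v u d h => ?_⟩
    simp only [map_add, map_mul, map_pow, hp C v u d h, hq C v u d h, aeval_X, Option.elim_none]
    ring
  | mul_X p i hp =>
    obtain ⟨N, p', hp⟩ := hp
    refine ⟨N + 1, p' * X (some i), fun C _ _ v u d h => ?_⟩
    simp only [map_mul, hp C v u d h, aeval_X, Option.elim_some, ← h i]
    ring

variable {n : ℕ}

/-- The inverse Cayley transform of a skew-symmetric matrix is orthogonal. -/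
theorem cayley_orthogonal {C : Type} [CommRing C] {Z W : Matrix (Fin n) (Fin n) C}
    (hZ : Zᵀ = -Z) (hW : (1 + Z) * W = 1) : ((1 - Z) * W)ᵀ * ((1 - Z) * W) = 1 := by
  have hW' : Wᵀ * (1 - Z) = 1 := by
    have := congrArg transpose hW
    rwa [transpose_mul, transpose_add, hZ, transpose_one, ← sub_eq_add_neg] at this
  have hc : (1 + Z) * (1 - Z) = (1 - Z) * (1 + Z) := by noncomm_ring
  calc ((1 - Z) * W)ᵀ * ((1 - Z) * W) = Wᵀ * ((1 + Z) * (1 - Z)) * W := by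
        rw [transpose_mul, transpose_sub, hZ, transpose_one, sub_neg_eq_add]
        simp only [Matrix.mul_assoc]
    _ = (Wᵀ * (1 - Z)) * ((1 + Z) * W) := by rw [hc]; simp only [Matrix.mul_assoc]
    _ = 1 := by rw [hW, hW', Matrix.one_mul]

/-- The Cayley transform of an orthogonal matrix is skew-symmetric. -/
theorem cayley_skew {C : Type} [CommRing C] {y B : Matrix (Fin n) (Fin n) C}
    (hy : yᵀ * y = 1) (hB : (1 + y) * B = 1) : ((1 - y) * B)ᵀ = -((1 - y) * B) := by
  have hB' : B * (1 + y) = 1 := mul_eq_one_comm.mp hB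
  have hBt : Bᵀ * (1 + yᵀ) = 1 := by
    have := congrArg transpose hB
    rwa [transpose_mul, transpose_add, transpose_one] at this
  have hk : (1 - yᵀ) * (1 + y) + (1 + yᵀ) * (1 - y) = 0 := by
    simp only [Matrix.sub_mul, Matrix.add_mul, Matrix.mul_add, Matrix.mul_sub, hy, Matrix.one_mul,
      Matrix.mul_one]
    abel
  have : Bᵀ * ((1 - yᵀ) * (1 + y) + (1 + yᵀ) * (1 - y)) * B = 0 := by
    rw [hk, Matrix.mul_zero, Matrix.zero_mul]
  rw [Matrix.mul_add, Matrix.add_mul] at this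
  have e1 : Bᵀ * ((1 - yᵀ) * (1 + y)) * B = ((1 - y) * B)ᵀ := by
    rw [transpose_mul, transpose_sub, transpose_one, Matrix.mul_assoc, Matrix.mul_assoc, hB,
      Matrix.mul_one]
  have e2 : Bᵀ * ((1 + yᵀ) * (1 - y)) * B = (1 - y) * B := by
    rw [← Matrix.mul_assoc Bᵀ, hBt, Matrix.one_mul]
  rw [e1, e2] at this
  exact eq_neg_of_add_eq_zero_left this

/-- The matrix of coordinate functions. -/
noncomputable def genericMatrix (F : Type) [Field F] (n : ℕ) :
    Matrix (Fin n) (Fin n) (MvPolynomial (Fin n × Fin n) F) :=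
  of fun i j => X (i, j)

/-- The ideal generated by the entries of `xᵀ * x - 1`. -/
noncomputable def orthIdeal (F : Type) [Field F] (n : ℕ) :
    Ideal (MvPolynomial (Fin n × Fin n) F) :=
  Ideal.span (Set.range fun q : Fin n × Fin n =>
    ((genericMatrix F n)ᵀ * genericMatrix F n - 1) q.1 q.2)

/-- Evaluation of a polynomial in the matrix entries. -/
noncomputable def evalMat {F C : Type} [Field F] [CommRing C] [Algebra F C]
    (g : Matrix (Fin n) (Fin n) C) : MvPolynomial (Fin n × Fin n) F →ₐ[F] C :=
  aeval fun q => g q.1 q.2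

theorem map_evalMat_genericMatrix {F C : Type} [Field F] [CommRing C] [Algebra F C]
    (g : Matrix (Fin n) (Fin n) C) :
    (genericMatrix F n).map (evalMat g) = g := by
  ext i j
  simp [genericMatrix, evalMat]

theorem evalMat_eq_zero_of_mem_orthIdeal {F C : Type} [Field F] [CommRing C] [Algebra F C]
    {g : Matrix (Fin n) (Fin n) C} (hg : gᵀ * g = 1) {f : MvPolynomial (Fin n × Fin n) F}
    (hf : f ∈ orthIdeal F n) : evalMat g f = 0 := by
  suffices orthIdeal F n ≤ RingHom.ker (evalMat (F := F) g) from this hf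
  rw [orthIdeal, Ideal.span_le]
  rintro _ ⟨⟨i, j⟩, rfl⟩
  have h := congrFun (congrFun hg i) j
  rw [← map_evalMat_genericMatrix (F := F) g, ← transpose_map, ← Matrix.map_mul] at h
  simp only [SetLike.mem_coe, RingHom.mem_ker, Matrix.sub_apply, map_sub]
  rw [Matrix.map_apply] at h
  rw [h, sub_eq_zero]
  by_cases hij : i = j <;> simp [Matrix.one_apply, hij]

theorem evalMat_comp_evalMat {F C D : Type} [Field F] [CommRing C] [Algebra F C] [CommRing D]
    [Algebra F D] (φ : C →ₐ[F] D) (g : Matrix (Fin n) (Fin n) C)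
    (f : MvPolynomial (Fin n × Fin n) F) : φ (evalMat g f) = evalMat (g.map φ) f := by
  simp only [evalMat, ← AlgHom.comp_apply, comp_aeval]
  rfl

/-- The fractions in the inverse Cayley transform, with the denominator as coordinate `none`. -/
noncomputable def cayleyCoords {D : Type} [CommRing D] (h Z : Matrix (Fin n) (Fin n) D) :
    Option (Fin n × Fin n) → D :=
  fun o => o.elim (1 + Z).det fun q => (h * ((1 - Z) * (1 + Z).adjugate)) q.1 q.2

theorem map_cayleyCoords {F D E : Type} [Field F] [CommRing D] [CommRing E] [Algebra F D]
    [Algebra F E] (φ : D →ₐ[F] E) (h : Matrix (Fin n) (Fin n) F) (Z : Matrix (Fin n) (Fin n) D)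
    (o : Option (Fin n × Fin n)) :
    φ (cayleyCoords (h.map (algebraMap F D)) Z o) =
      cayleyCoords (h.map (algebraMap F E)) (Z.map φ) o := by
  have hadd : (1 + Z).map φ = 1 + Z.map φ := by
    ext i j; by_cases hij : i = j <;> simp [hij]
  have hsub : (1 - Z).map φ = 1 - Z.map φ := by
    ext i j; by_cases hij : i = j <;> simp [hij]
  cases o with
  | none =>
    simp only [cayleyCoords, Option.elim_none]
    rw [← hadd, AlgHom.map_det]
    rfl
  | some q =>
    simp only [cayleyCoords, Option.elim_some]
    have hadj : (1 + Z).adjugate.map φ = (1 + Z.map φ).adjugate := by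
      rw [← hadd]
      exact RingHom.map_adjugate φ.toRingHom (1 + Z)
    have hh : (h.map (algebraMap F D)).map φ = h.map (algebraMap F E) := by
      ext i j; simp
    rw [← hadj, ← hsub, ← hh, ← Matrix.map_mul, ← Matrix.map_mul]
    rfl

/-- A polynomial vanishing on the orthogonal group vanishes at orthogonal matrices `x` over
`F`-algebras such that `1 + hᵀ * x` is invertible for some orthogonal `h` over `F`. -/
theorem evalMat_eq_zero_of_isUnit_det {F C : Type} [Field F] [CharZero F] [CommRing C] [Algebra F C]
    {f : MvPolynomial (Fin n × Fin n) F} (hf : ∀ g ∈ orthSet F n, evalMat g f = 0)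
    {h : Matrix (Fin n) (Fin n) F} (hh : h ∈ orthSet F n) {x : Matrix (Fin n) (Fin n) C}
    (hx : xᵀ * x = 1) (hu : IsUnit (1 + (h.map (algebraMap F C))ᵀ * x).det) :
    evalMat x f = 0 := by
  obtain ⟨N, f', hf'⟩ := exists_homogenization f
  have hfrac : ∀ (D : Type) [CommRing D] [Algebra F D] (Z W : Matrix (Fin n) (Fin n) D),
      (1 + Z) * W = 1 → aeval (cayleyCoords (h.map (algebraMap F D)) Z) f' =
        (1 + Z).det ^ N * evalMat (h.map (algebraMap F D) * ((1 - Z) * W)) f := by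
    intro D _ _ Z W hW
    have hadj : (1 + Z).adjugate = (1 + Z).det • W := by
      calc (1 + Z).adjugate = (1 + Z).adjugate * ((1 + Z) * W) := by rw [hW, Matrix.mul_one]
        _ = _ := by rw [← Matrix.mul_assoc, adjugate_mul, Matrix.smul_mul, Matrix.one_mul]
    apply hf'
    intro q
    simp only [hadj, Matrix.mul_smul, Matrix.smul_apply, smul_eq_mul]
    rw [mul_comm]
  let G := genericMatrix F n
  let Z₀ := G - Gᵀ
  let Q := aeval (cayleyCoords (h.map (algebraMap F _)) Z₀) f'
  have hspec : ∀ (D : Type) [CommRing D] [Algebra F D] (z : Matrix (Fin n) (Fin n) D),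
      evalMat z Q = aeval (cayleyCoords (h.map (algebraMap F D)) (z - zᵀ)) f' := by
    intro D _ _ z
    have hz : Z₀.map (evalMat z) = z - zᵀ := by
      ext i j; simp [Z₀, G, evalMat, genericMatrix]
    simp only [Q, ← AlgHom.comp_apply, comp_aeval, ← hz]
    congr 2
    funext o
    exact map_cayleyCoords _ _ _ _
  have hdspec : ∀ (D : Type) [CommRing D] [Algebra F D] (z : Matrix (Fin n) (Fin n) D),
      evalMat z (1 + Z₀).det = (1 + (z - zᵀ)).det := by
    intro D _ _ z
    rw [AlgHom.map_det]
    congr 1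
    ext i j; by_cases hij : i = j <;> simp [hij, Z₀, G, evalMat, genericMatrix]
  have hQ : (1 + Z₀).det * Q = 0 := by
    apply MvPolynomial.funext
    intro z₀
    let z : Matrix (Fin n) (Fin n) F := of fun i j => z₀ (i, j)
    have hev : ∀ p, eval z₀ p = evalMat z p := fun p => by
      rw [evalMat, aeval_eq_eval]; rfl
    rw [hev, hev, map_mul, map_zero, hdspec, hspec]
    by_cases hd : (1 + (z - zᵀ)).det = 0
    · rw [hd, zero_mul]
    · have hW := Matrix.mul_nonsing_inv _ (isUnit_iff_ne_zero.mpr hd)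
      rw [hfrac F _ _ hW, hf, mul_zero, mul_zero]
      have hc := cayley_orthogonal (Z := z - zᵀ) (by simp [transpose_sub]) hW
      have hid : h.map (algebraMap F F) = h := by ext; simp
      rw [orthSet, Set.mem_ofPred_eq, hid, transpose_mul, Matrix.mul_assoc, ← Matrix.mul_assoc _ h,
        show hᵀ * h = 1 from hh, Matrix.one_mul, hc]
  -- specialize at half of the Cayley transform of `hᵀ * x`
  set hC := h.map (algebraMap F C) with hCdef
  have hhC : hCᵀ * hC = 1 := by
    rw [hCdef, ← transpose_map, ← Matrix.map_mul, show hᵀ * h = 1 from hh]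
    ext i j; by_cases hij : i = j <;> simp [Matrix.one_apply, hij]
  have hhC' : hC * hCᵀ = 1 := mul_eq_one_comm.mp hhC
  set y := hCᵀ * x with hy
  have hyy : yᵀ * y = 1 := by
    rw [hy, transpose_mul, transpose_transpose, Matrix.mul_assoc, ← Matrix.mul_assoc hC, hhC',
      Matrix.one_mul, hx]
  set B := (1 + y)⁻¹ with hB
  have hBr : (1 + y) * B = 1 := Matrix.mul_nonsing_inv _ hu
  have hBl : B * (1 + y) = 1 := Matrix.nonsing_inv_mul _ hu
  set A := (1 - y) * B with hA
  have hskew : Aᵀ = -A := cayley_skew hyy hBr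
  let t : C := algebraMap F C 2⁻¹
  have ht : t * 2 = 1 := by
    rw [← map_ofNat (algebraMap F C) 2, ← map_mul, inv_mul_cancel₀ two_ne_zero, map_one]
  have ht' : t • A - (t • A)ᵀ = A := by
    rw [transpose_smul, hskew, smul_neg, sub_neg_eq_add, ← two_smul C (t • A), smul_smul, mul_comm,
      ht, one_smul]
  have h1A : 1 + A = (2 : C) • B := by
    calc 1 + A = (1 + y) * B + (1 - y) * B := by rw [hBr]
      _ = (2 : C) • B := by rw [← Matrix.add_mul, two_smul]; noncomm_ring
  have hW : (1 + A) * (t • (1 + y)) = 1 := by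
    rw [h1A, Matrix.smul_mul, Matrix.mul_smul, hBl, smul_smul, mul_comm, ht, one_smul]
  have hx' : hC * ((1 - A) * (t • (1 + y))) = x := by
    have h1 : 1 - A = (2 : C) • (y * B) := by
      calc 1 - A = (1 + y) * B - (1 - y) * B := by rw [hBr]
        _ = (2 : C) • (y * B) := by rw [← Matrix.sub_mul, two_smul]; noncomm_ring
    rw [h1, Matrix.smul_mul, Matrix.mul_smul (y * B), Matrix.mul_assoc y, hBl, smul_smul, mul_comm, ht,
      one_smul, Matrix.mul_one, hy, ← Matrix.mul_assoc, hhC', Matrix.one_mul]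
  have hfin := congrArg (evalMat (t • A)) hQ
  rw [map_mul, map_zero, hdspec, hspec, ht', hfrac C _ _ hW, hx', ← mul_assoc, ← pow_succ'] at hfin
  have hdu : IsUnit (1 + A).det := (Matrix.isUnit_iff_isUnit_det _).mp
    (IsUnit.of_mul_eq_one _ hW)
  exact (hdu.pow _).mul_right_eq_zero.mp hfin

theorem map_eq_zero_of_isUnit_det {F C : Type} [Field F] [CharZero F] [CommRing C] [Algebra F C]
    {f : MvPolynomial (Fin n × Fin n) F} (hf : ∀ g ∈ orthSet F n, evalMat g f = 0)
    {h : Matrix (Fin n) (Fin n) F} (hh : h ∈ orthSet F n)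
    (φ : MvPolynomial (Fin n × Fin n) F →ₐ[F] C) (hφI : ∀ p ∈ orthIdeal F n, φ p = 0)
    (hu : IsUnit (φ (1 + (h.map (algebraMap F _))ᵀ * genericMatrix F n).det)) : φ f = 0 := by
  have hφ : φ f = evalMat ((genericMatrix F n).map φ) f := by
    rw [← evalMat_comp_evalMat]
    congr 1
    exact (aeval_X_left_apply f).symm
  rw [hφ]
  refine evalMat_eq_zero_of_isUnit_det hf hh ?_ ?_
  · rw [← transpose_map, ← Matrix.map_mul, ← sub_eq_zero]
    ext i j
    have h1 := hφI _ (Ideal.subset_span ⟨(i, j), rfl⟩)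
    rw [← Matrix.zero_apply i j] at h1
    refine Eq.trans ?_ h1
    by_cases hij : i = j <;> simp [hij, Matrix.mul_apply]
  · rw [AlgHom.map_det] at hu
    convert hu using 2
    ext i j; by_cases hij : i = j <;> simp [hij, Matrix.mul_apply]

theorem exists_det_pow_mul_mem_orthIdeal {F : Type} [Field F] [CharZero F]
    {f : MvPolynomial (Fin n × Fin n) F} (hf : ∀ g ∈ orthSet F n, evalMat g f = 0)
    {h : Matrix (Fin n) (Fin n) F} (hh : h ∈ orthSet F n) :
    ∃ N, (1 + (h.map (algebraMap F _))ᵀ * genericMatrix F n).det ^ N * f ∈ orthIdeal F n := by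
  set d := (1 + (h.map (algebraMap F _))ᵀ * genericMatrix F n).det with hd
  let π := Ideal.Quotient.mkₐ F (orthIdeal F n)
  have hzero := map_eq_zero_of_isUnit_det hf hh
    ((IsScalarTower.toAlgHom F _ (Localization.Away (π d))).comp π)
    (fun p hp => by
      rw [AlgHom.comp_apply, show π p = 0 from Ideal.Quotient.eq_zero_iff_mem.mpr hp, map_zero])
    (IsLocalization.Away.algebraMap_isUnit (π d))
  obtain ⟨⟨_, N, rfl⟩, hN⟩ :=
    (IsLocalization.map_eq_zero_iff (Submonoid.powers (π d)) _ (π f)).mp hzero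
  refine ⟨N, ?_⟩
  rw [← Ideal.Quotient.eq_zero_iff_mem]
  exact (by simpa using hN : π (d ^ N * f) = 0)

/-- The ideal of the orthogonal group is generated by the entries of `xᵀ * x - 1`. -/
theorem mem_orthIdeal_of_forall_evalMat_eq_zero {F : Type} [Field F] [IsAlgClosed F] [CharZero F]
    {f : MvPolynomial (Fin n × Fin n) F} (hf : ∀ g ∈ orthSet F n, evalMat g f = 0) :
    f ∈ orthIdeal F n := by
  let J := (orthIdeal F n).colon {f}
  have hJ : ∀ {p}, p ∈ J ↔ p * f ∈ orthIdeal F n := Submodule.mem_colon_singleton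
  by_contra hfI
  have hJtop : J ≠ ⊤ := fun h => hfI <| by
    simpa using hJ.mp ((Ideal.eq_top_iff_one J).mp h)
  obtain ⟨M, hM, hJM⟩ := Ideal.exists_le_maximal J hJtop
  obtain ⟨h₀, rfl⟩ := (MvPolynomial.isMaximal_iff_eq_vanishingIdeal_singleton (K := F)).mp hM
  let h : Matrix (Fin n) (Fin n) F := of fun i j => h₀ (i, j)
  have hev : ∀ p ∈ J, evalMat h p = 0 := fun p hp =>
    (MvPolynomial.mem_vanishingIdeal_singleton_iff _ _).mp (hJM hp)
  have hh : h ∈ orthSet F n := by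
    have hker : ∀ q : Fin n × Fin n,
        evalMat h (((genericMatrix F n)ᵀ * genericMatrix F n - 1) q.1 q.2) = 0 := fun q =>
      hev _ (hJ.mpr (Ideal.mul_mem_right _ _ (Ideal.subset_span ⟨q, rfl⟩)))
    have h1 : (((genericMatrix F n)ᵀ * genericMatrix F n - 1).map (evalMat h)) = hᵀ * h - 1 := by
      conv_rhs => rw [← map_evalMat_genericMatrix (F := F) h, ← transpose_map, ← Matrix.map_mul]
      ext i j; by_cases hij : i = j <;> simp [hij, Matrix.mul_apply]
    rw [orthSet, Set.mem_ofPred_eq, ← sub_eq_zero, ← h1]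
    ext i j
    exact hker (i, j)
  obtain ⟨N, hN⟩ := exists_det_pow_mul_mem_orthIdeal hf hh
  have hfin := hev _ (hJ.mpr hN)
  rw [map_pow, pow_eq_zero_iff', AlgHom.map_det] at hfin
  refine absurd hfin.1 ?_
  have h2 : (evalMat (F := F) h).mapMatrix (1 + (h.map (algebraMap F _))ᵀ * genericMatrix F n) = (2 : F) • 1 := by
    rw [map_add, map_mul, map_one]
    have e1 : (evalMat (F := F) h).mapMatrix (genericMatrix F n) = h := map_evalMat_genericMatrix h
    have e2 : (evalMat (F := F) h).mapMatrix ((h.map (algebraMap F _))ᵀ) = hᵀ := by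
      ext i j; simp
    rw [e1, e2, show hᵀ * h = 1 from hh, two_smul]
  rw [h2, det_smul, det_one, mul_one]
  exact pow_ne_zero _ two_ne_zero

end Cayley

section ContractionClosed

/-- A graded contraction-closed subalgebra of the tensor algebra containing `∑ eᵢ ⊗ eᵢ`. -/
structure IsContractionClosed {K : Type} [Field K] {n : ℕ}
    (A : ∀ k : ℕ, Submodule K (Tensor K n k)) : Prop where
  one_mem : (fun _ => 1 : Tensor K n 0) ∈ A 0
  mul_mem : ∀ (k l : ℕ) (a : Tensor K n k) (b : Tensor K n l),
    a ∈ A k → b ∈ A l → tmul a b ∈ A (k + l)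
  contract_mem : ∀ (m : ℕ) (i j : Fin (m + 2)), i < j → ∀ a ∈ A (m + 2), tcontract i j a ∈ A m
  diag_mem : (fun φ => if φ 0 = φ 1 then 1 else 0 : Tensor K n 2) ∈ A 2

namespace IsContractionClosed

variable {K : Type} [Field K] {n : ℕ} {A : ∀ k : ℕ, Submodule K (Tensor K n k)}

/-- The cyclic permutation moving `i` to the last position. -/
def toLast {m : ℕ} (i : Fin (m + 1)) : Equiv.Perm (Fin (m + 1)) :=
  (finSuccEquiv' i).trans (finSuccEquiv' (Fin.last m)).symm

theorem toLast_self {m : ℕ} (i : Fin (m + 1)) : toLast i i = Fin.last m := by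
  simp [toLast]

theorem toLast_succAbove {m : ℕ} (i : Fin (m + 1)) (j : Fin m) :
    toLast i (i.succAbove j) = j.castSucc := by
  simp [toLast]

theorem toLast_apply_val {m : ℕ} (i j : Fin (m + 1)) :
    (toLast i j).val = if j.val < i.val then j.val else if j.val = i.val then m else j.val - 1 := by
  rcases Fin.eq_self_or_eq_succAbove i j with rfl | ⟨l, rfl⟩
  · simp [toLast_self]
  · rw [toLast_succAbove]
    simp only [Fin.succAbove, Fin.lt_def, Fin.val_castSucc]
    split_ifs <;> simp_all <;> omega

theorem insertNth_of_eq_succAbove {α : Type} {m : ℕ} (p : Fin (m + 1)) (c : α) (f : Fin m → α)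
    (x : Fin (m + 1)) (j : Fin m) (hx : x = p.succAbove j) :
    Fin.insertNth (α := fun _ => α) p c f x = f j := by
  subst hx
  simp

theorem comp_toLast_mem (hA : IsContractionClosed A) {m : ℕ} {t : Tensor K n (m + 1)}
    (ht : t ∈ A (m + 1)) (i : Fin (m + 1)) : (fun φ => t (φ ∘ toLast i)) ∈ A (m + 1) := by
  have h := hA.contract_mem (m + 1) i.castSucc.castSucc ⟨m + 1, by omega⟩
    (by have := i.isLt; simp only [Fin.lt_def, Fin.val_castSucc]; omega) _
    (hA.mul_mem _ _ _ _ ht hA.diag_mem)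
  convert h using 1
  funext φ
  have key : ∀ c, (tmul t (fun φ => if φ 0 = φ 1 then 1 else 0) : Tensor K n (m + 1 + 2))
      (Fin.insertNth (α := fun _ => Fin n) i.castSucc.castSucc c
        (Fin.insertNth (α := fun _ => Fin n) (⟨m, by omega⟩ : Fin (m + 1 + 1)) c φ)) =
      if c = φ (Fin.last m) then t (φ ∘ toLast i) else 0 := by
    intro c
    have hi := i.isLt
    have h1 : (Fin.insertNth (α := fun _ => Fin n) i.castSucc.castSucc c
        (Fin.insertNth (α := fun _ => Fin n) (⟨m, by omega⟩ : Fin (m + 1 + 1)) c φ))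
        (Fin.natAdd (m + 1) (0 : Fin 2)) = c := by
      rw [insertNth_of_eq_succAbove _ _ _ _ (⟨m, by omega⟩ : Fin (m + 1 + 1))]
      · simp
      · ext
        simp only [Fin.succAbove, Fin.lt_def, Fin.val_castSucc]
        split_ifs <;> simp <;> omega
    have h2 : (Fin.insertNth (α := fun _ => Fin n) i.castSucc.castSucc c
        (Fin.insertNth (α := fun _ => Fin n) (⟨m, by omega⟩ : Fin (m + 1 + 1)) c φ))
        (Fin.natAdd (m + 1) (1 : Fin 2)) = φ (Fin.last m) := by
      rw [insertNth_of_eq_succAbove _ _ _ _ (⟨m + 1, by omega⟩ : Fin (m + 1 + 1)),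
        insertNth_of_eq_succAbove _ _ _ _ (Fin.last m)]
      · ext
        simp [Fin.succAbove, Fin.lt_def]
      · ext
        simp only [Fin.succAbove, Fin.lt_def, Fin.val_castSucc]
        split_ifs <;> simp <;> omega
    simp only [tmul]
    simp only [h1, h2]
    split_ifs with hc
    · rw [mul_one]
      congr 1
      funext x
      rcases Fin.eq_self_or_eq_succAbove i x with rfl | ⟨j, rfl⟩
      · rw [Function.comp_apply, toLast_self, ← hc]
        exact Fin.insertNth_apply_same (α := fun _ => Fin n) _ _ _
      · have hj := j.isLt
        rw [Function.comp_apply, toLast_succAbove,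
          insertNth_of_eq_succAbove _ _ _ _ j.castSucc.castSucc,
          insertNth_of_eq_succAbove _ _ _ _ j.castSucc]
        · ext
          simp only [Fin.succAbove, Fin.lt_def, Fin.val_castSucc]
          split_ifs <;> simp
        · ext
          simp only [Fin.succAbove, Fin.lt_def, Fin.val_castSucc]
          split_ifs <;> simp
    · rw [mul_zero]
  simp only [tcontract]
  refine Eq.trans ?_ (Finset.sum_congr rfl fun c _ => (key c).symm)
  simp

theorem swap_mem_of_toLast {m : ℕ} (S : Subgroup (Equiv.Perm (Fin (m + 1))))
    (h : ∀ i, toLast i ∈ S) : S = ⊤ := by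
  rw [← top_le_iff]
  have h1 : (⊤ : Submonoid (Equiv.Perm (Fin (m + 1)))) ≤ S.toSubmonoid := by
    rw [← Equiv.Perm.mclosure_swap_castSucc_succ, Submonoid.closure_le]
    rintro _ ⟨i, rfl⟩
    show Equiv.swap i.castSucc i.succ ∈ S
    have : Equiv.swap i.castSucc i.succ = (toLast i.castSucc)⁻¹ * toLast i.succ := by
      rw [eq_inv_mul_iff_mul_eq]
      ext j : 1
      have hi := i.isLt
      have hj := j.isLt
      apply Fin.ext
      simp only [Equiv.Perm.mul_apply, toLast_apply_val, Equiv.swap_apply_def, Fin.ext_iff]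
      split_ifs <;> simp_all <;> omega
    rw [this]
    exact S.mul_mem (S.inv_mem (h _)) (h _)
  exact fun x _ => h1 trivial

theorem perm_mem (hA : IsContractionClosed A) {k : ℕ} {t : Tensor K n k} (ht : t ∈ A k)
    (σ : Equiv.Perm (Fin k)) : (fun φ => t (φ ∘ σ)) ∈ A k := by
  cases k with
  | zero => convert ht
  | succ m =>
    let M : Submonoid (Equiv.Perm (Fin (m + 1))) :=
      { carrier := {σ | ∀ t ∈ A (m + 1), (fun φ => t (φ ∘ σ)) ∈ A (m + 1)}
        one_mem' := fun t ht => ht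
        mul_mem' := fun {a b} ha hb t ht => ha _ (hb t ht) }
    let S : Subgroup (Equiv.Perm (Fin (m + 1))) :=
      { M with
        inv_mem' := fun {x} hx => by
          have : x⁻¹ = x ^ (orderOf x - 1) := by
            rw [inv_eq_iff_mul_eq_one, ← pow_succ', Nat.sub_add_cancel (orderOf_pos x),
              pow_orderOf_eq_one]
          rw [this]
          exact M.pow_mem hx _ }
    have hS := swap_mem_of_toLast S fun i t ht => hA.comp_toLast_mem ht i
    have : σ ∈ S := hS ▸ Subgroup.mem_top σ
    exact this t ht

end IsContractionClosed
end ContractionClosed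

section ContractionClosedIndexed
namespace IsContractionClosed

variable {K : Type} [Field K] {n : ℕ} {A : ∀ k : ℕ, Submodule K (Tensor K n k)}

/-- The tensors with factors indexed by `ι` that lie in `A` under every enumeration of `ι`. -/
def indexed (A : ∀ k : ℕ, Submodule K (Tensor K n k)) (ι : Type) :
    Submodule K ((ι → Fin n) → K) where
  carrier := {T | ∀ (k : ℕ) (e : Fin k ≃ ι), (fun φ : Fin k → Fin n => T (φ ∘ e.symm)) ∈ A k}
  add_mem' ha hb k e := (A k).add_mem (ha k e) (hb k e)
  zero_mem' k _ := (A k).zero_mem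
  smul_mem' c _ ha k e := (A k).smul_mem c (ha k e)

theorem mem_indexed_of_equiv (hA : IsContractionClosed A) {ι : Type} {T : (ι → Fin n) → K} {k : ℕ}
    (e : Fin k ≃ ι) (h : (fun φ : Fin k → Fin n => T (φ ∘ e.symm)) ∈ A k) : T ∈ indexed A ι := by
  intro k' e'
  obtain rfl : k = k' := by
    simpa using Fintype.card_congr (e.trans e'.symm)
  convert hA.perm_mem h (e.trans e'.symm) using 1
  funext φ
  congr 1
  funext i
  simp

theorem mem_indexed_fin (hA : IsContractionClosed A) {k : ℕ} {t : Tensor K n k} (ht : t ∈ A k) :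
    t ∈ indexed A (Fin k) :=
  hA.mem_indexed_of_equiv (Equiv.refl _) ht

theorem mem_of_mem_indexed_fin {k : ℕ} {t : Tensor K n k} (ht : t ∈ indexed A (Fin k)) : t ∈ A k :=
  ht k (Equiv.refl _)

theorem indexed_reindex {ι κ : Type} {T : (ι → Fin n) → K} (hT : T ∈ indexed A ι) (e : ι ≃ κ) :
    (fun φ : κ → Fin n => T (φ ∘ e)) ∈ indexed A κ := fun k f => hT k (f.trans e.symm)

theorem indexed_mul (hA : IsContractionClosed A) {ι κ : Type} [Finite ι] [Finite κ]
    {T : (ι → Fin n) → K} {S : (κ → Fin n) → K} (hT : T ∈ indexed A ι) (hS : S ∈ indexed A κ) :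
    (fun φ : ι ⊕ κ → Fin n => T (φ ∘ Sum.inl) * S (φ ∘ Sum.inr)) ∈ indexed A (ι ⊕ κ) := by
  obtain ⟨k, ⟨e⟩⟩ := Finite.exists_equiv_fin ι
  obtain ⟨l, ⟨f⟩⟩ := Finite.exists_equiv_fin κ
  refine hA.mem_indexed_of_equiv (finSumFinEquiv.symm.trans (e.symm.sumCongr f.symm)) ?_
  convert hA.mul_mem _ _ _ _ (hT k e.symm) (hS l f.symm) using 1
  funext φ
  simp only [tmul]
  congr 2

theorem indexed_contract (hA : IsContractionClosed A) {κ : Type} [Finite κ]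
    {T : (Option (Option κ) → Fin n) → K} (hT : T ∈ indexed A (Option (Option κ))) :
    (fun φ : κ → Fin n => ∑ c, T fun o => o.elim c fun o' => o'.elim c φ) ∈ indexed A κ := by
  obtain ⟨k, ⟨e⟩⟩ := Finite.exists_equiv_fin κ
  refine hA.mem_indexed_of_equiv e.symm ?_
  let E : Fin (k + 2) ≃ Option (Option κ) :=
    (_root_.finSuccEquiv (k + 1)).trans (((_root_.finSuccEquiv k).trans e.symm.optionCongr).optionCongr)
  convert hA.contract_mem k 0 1 (by simp) _ (hT _ E) using 1
  funext φ
  simp only [tcontract]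
  refine Finset.sum_congr rfl fun c _ => ?_
  congr 1
  funext o
  have h1 : E 0 = none := by simp [E]
  have h2 : E (Fin.succ 0) = some none := by
    simp only [E, Equiv.trans_apply, finSuccEquiv_succ]
    rw [Equiv.optionCongr_apply]
    simp [-Equiv.optionCongr_symm]
  have h3 : ∀ i : Fin k, E i.succ.succ = some (some (e.symm i)) := fun i => by
    simp only [E, Equiv.trans_apply, finSuccEquiv_succ]
    rw [Equiv.optionCongr_apply]
    simp [-Equiv.optionCongr_symm]
  obtain ⟨i, rfl⟩ := E.surjective o
  simp only [Function.comp_apply, Equiv.symm_apply_apply]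
  refine Fin.cases ?_ (fun i => Fin.cases ?_ (fun i => ?_) i) i
  · simp [h1]
  · rw [h2]
    simp
  · simp [h3]

theorem indexed_contract_pairs (hA : IsContractionClosed A) (ι : Type) [Finite ι] :
    ∀ {κ : Type} [Finite κ] {U : (κ ⊕ (ι ⊕ ι) → Fin n) → K}, U ∈ indexed A (κ ⊕ (ι ⊕ ι)) →
    (fun φ : κ → Fin n => ∑ᶠ J : ι → Fin n, U (Sum.elim φ (Sum.elim J J))) ∈ indexed A κ := by
  induction ι using Finite.induction_empty_option with
  | @of_equiv α β e ih =>
    intro κ _ U hU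
    convert ih (indexed_reindex hU
      ((Equiv.refl κ).sumCongr (e.symm.sumCongr e.symm))) using 1
    funext φ
    rw [← finsum_comp_equiv (e.arrowCongr (Equiv.refl (Fin n)))]
    refine finsum_congr fun J => ?_
    congr 1
    funext x
    rcases x with x | x | x <;> simp
  | h_empty =>
    intro κ _ U hU
    convert indexed_reindex hU (Equiv.sumEmpty κ (PEmpty ⊕ PEmpty)) using 1
    funext φ
    rw [finsum_eq_single _ (fun x => x.elim) (fun J hJ => (hJ (Subsingleton.elim _ _)).elim)]
    congr 1
    funext x
    rcases x with x | x | x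
    · rfl
    · exact x.elim
    · exact x.elim
  | @h_option α _ ih =>
    intro κ _ U hU
    let E : κ ⊕ (Option α ⊕ Option α) ≃ Option (Option (κ ⊕ (α ⊕ α))) :=
      { toFun := fun x => match x with
          | .inl x => some (some (.inl x))
          | .inr (.inl none) => none
          | .inr (.inr none) => some none
          | .inr (.inl (some x)) => some (some (.inr (.inl x)))
          | .inr (.inr (some x)) => some (some (.inr (.inr x)))
        invFun := fun x => match x with
          | none => .inr (.inl none)
          | some none => .inr (.inr none)
          | some (some (.inl x)) => .inl x
          | some (some (.inr (.inl x))) => .inr (.inl (some x))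
          | some (some (.inr (.inr x))) => .inr (.inr (some x))
        left_inv := by rintro (x | (_ | x) | (_ | x)) <;> rfl
        right_inv := by rintro (_ | _ | x | x | x) <;> rfl }
    convert ih (hA.indexed_contract (indexed_reindex hU E)) using 1
    funext φ
    classical
    have := Fintype.ofFinite α
    rw [finsum_eq_sum_of_fintype, finsum_eq_sum_of_fintype, Finset.sum_comm,
      ← (Equiv.piOptionEquivProd (β := fun _ : Option α => Fin n)).symm.sum_comp,
      Fintype.sum_prod_type]
    refine Finset.sum_congr rfl fun c _ => Finset.sum_congr rfl fun J _ => ?_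
    congr 1
    funext x
    rcases x with x | (_ | x) | (_ | x) <;> rfl

theorem indexed_pairing (hA : IsContractionClosed A) {ι κ : Type} [Fintype ι] [DecidableEq ι]
    [Finite κ] {T : (κ ⊕ ι → Fin n) → K} {S : (ι → Fin n) → K} (hT : T ∈ indexed A (κ ⊕ ι))
    (hS : S ∈ indexed A ι) :
    (fun φ : κ → Fin n => ∑ J : ι → Fin n, T (Sum.elim φ J) * S J) ∈ indexed A κ := by
  convert hA.indexed_contract_pairs ι
    (indexed_reindex (hA.indexed_mul hT hS) (Equiv.sumAssoc κ ι ι)) using 1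
  funext φ
  rw [finsum_eq_sum_of_fintype]
  refine Finset.sum_congr rfl fun J _ => ?_
  congr 2
  funext x
  rcases x with x | x <;> rfl

end IsContractionClosed
end ContractionClosedIndexed

theorem Submodule.exists_mem_dotProduct_eq {ι : Type} [Fintype ι] (U : Submodule ℚ (ι → ℚ))
    (v : ι → ℚ) : ∃ p ∈ U, ∀ u ∈ U, u ⬝ᵥ p = u ⬝ᵥ v := by
  let f : U →ₗ[ℚ] Module.Dual ℚ U :=
    ((dotProductBilin ℚ ℚ).flip.compl₁₂ U.subtype U.subtype)
  have hf : ∀ a b : U, f a b = (b : ι → ℚ) ⬝ᵥ (a : ι → ℚ) := fun a b => rfl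
  have hinj : Function.Injective f := by
    rw [injective_iff_map_eq_zero]
    intro a ha
    have := hf a a
    rw [ha, LinearMap.zero_apply, eq_comm, dotProduct_self_eq_zero] at this
    exact Subtype.ext this
  have hsurj := (LinearMap.injective_iff_surjective_of_finrank_eq_finrank
    (Subspace.dual_finrank_eq (K := ℚ) (V := U)).symm).1 hinj
  obtain ⟨p, hp⟩ := hsurj (((dotProductBilin ℚ ℚ).flip v).comp U.subtype)
  refine ⟨p, p.2, fun u hu => ?_⟩
  have := LinearMap.congr_fun hp ⟨u, hu⟩
  rwa [hf] at this

namespace IsContractionClosed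

/-- The smallest contraction-closed family over `ℚ`. -/
noncomputable def minimal (n k : ℕ) : Submodule ℚ (Tensor ℚ n k) :=
  ⨅ (A : ∀ k : ℕ, Submodule ℚ (Tensor ℚ n k)) (_ : IsContractionClosed A), A k

theorem mem_minimal {n k : ℕ} {t : Tensor ℚ n k} :
    t ∈ minimal n k ↔ ∀ A : ∀ k : ℕ, Submodule ℚ (Tensor ℚ n k), IsContractionClosed A → t ∈ A k := by
  simp [minimal, Submodule.mem_iInf]

theorem minimal_isContractionClosed (n : ℕ) : IsContractionClosed (minimal n) where
  one_mem := mem_minimal.2 fun _ hA => hA.one_mem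
  mul_mem k l a b ha hb := mem_minimal.2 fun A hA =>
    hA.mul_mem k l a b (mem_minimal.1 ha A hA) (mem_minimal.1 hb A hA)
  contract_mem m i j hij a ha := mem_minimal.2 fun A hA =>
    hA.contract_mem m i j hij a (mem_minimal.1 ha A hA)
  diag_mem := mem_minimal.2 fun _ hA => hA.diag_mem

/-- The rational points of a contraction-closed family. -/
def rationalPoints {F : Type} [Field F] [CharZero F] {n : ℕ} (A : ∀ k : ℕ, Submodule F (Tensor F n k))
    (k : ℕ) : Submodule ℚ (Tensor ℚ n k) where
  carrier := {t | (fun φ => (t φ : F)) ∈ A k}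
  add_mem' {a b} ha hb := by
    have := (A k).add_mem ha hb
    simpa [Pi.add_def] using this
  zero_mem' := by
    have := (A k).zero_mem
    simpa [Pi.zero_def] using this
  smul_mem' c a ha := by
    have := (A k).smul_mem (c : F) ha
    simpa [Pi.smul_def] using this

theorem rationalPoints_isContractionClosed {F : Type} [Field F] [CharZero F] {n : ℕ}
    {A : ∀ k : ℕ, Submodule F (Tensor F n k)} (hA : IsContractionClosed A) :
    IsContractionClosed (rationalPoints A) where
  one_mem := by simpa [rationalPoints] using hA.one_mem
  mul_mem k l a b ha hb := by
    have := hA.mul_mem k l _ _ ha hb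
    unfold tmul at this
    simpa [rationalPoints, tmul] using this
  contract_mem m i j hij a ha := by
    have := hA.contract_mem m i j hij _ ha
    unfold tcontract at this
    simpa [rationalPoints, tcontract] using this
  diag_mem := by
    have := hA.diag_mem
    simpa [rationalPoints, apply_ite (Rat.cast (K := F))] using this

variable {n : ℕ}

section

variable {ι κ : Type} [Fintype ι] [Fintype κ] [DecidableEq ι] [DecidableEq κ]

/-- The matrix of the orthogonal projection onto the minimal contraction-closed family. -/
noncomputable def projMatrix (I J : ι → Fin n) : ℚ :=
  ((indexed (minimal n) ι).exists_mem_dotProduct_eq (Pi.single J 1)).choose I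

theorem projMatrix_mem (J : ι → Fin n) :
    (fun I => projMatrix I J) ∈ indexed (minimal n) ι :=
  ((indexed (minimal n) ι).exists_mem_dotProduct_eq (Pi.single J 1)).choose_spec.1

theorem sum_mul_projMatrix {u : (ι → Fin n) → ℚ} (hu : u ∈ indexed (minimal n) ι)
    (J : ι → Fin n) : ∑ I, u I * projMatrix I J = u J := by
  have := ((indexed (minimal n) ι).exists_mem_dotProduct_eq (Pi.single J 1)).choose_spec.2 u hu
  rw [dotProduct_single_one] at this
  exact this

theorem eq_projMatrix {q : (ι → Fin n) → ℚ} (hq : q ∈ indexed (minimal n) ι) (J : ι → Fin n)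
    (h : ∀ u ∈ indexed (minimal n) ι, ∑ I, u I * q I = u J) (I : ι → Fin n) :
    q I = projMatrix I J := by
  let r := q - fun I => projMatrix I J
  have hr : r ∈ indexed (minimal n) ι := sub_mem hq (projMatrix_mem J)
  have : r ⬝ᵥ r = 0 := by
    have h1 : r ⬝ᵥ r = ∑ I, r I * q I - ∑ I, r I * projMatrix I J := by
      rw [← Finset.sum_sub_distrib]
      exact Finset.sum_congr rfl fun I _ => by simp [r]; ring
    rw [h1, h r hr, sum_mul_projMatrix hr, sub_self]
  rw [dotProduct_self_eq_zero] at this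
  exact sub_eq_zero.1 (congrFun this I)

theorem projMatrix_comm (I J : ι → Fin n) : projMatrix I J = projMatrix J I := by
  rw [← sum_mul_projMatrix (projMatrix_mem J) I, ← sum_mul_projMatrix (projMatrix_mem I) J]
  exact Finset.sum_congr rfl fun K _ => mul_comm _ _

theorem projMatrix_comp (e : ι ≃ κ) (I J : κ → Fin n) :
    projMatrix (I ∘ e) (J ∘ e) = projMatrix I J := by
  refine eq_projMatrix (indexed_reindex (projMatrix_mem (J ∘ e)) e) J (fun u hu => ?_) I
  rw [← (e.arrowCongr (Equiv.refl (Fin n))).sum_comp]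
  have := sum_mul_projMatrix (indexed_reindex hu e.symm) (J ∘ e)
  refine Eq.trans ?_ (this.trans (congrArg u (by funext x; simp)))
  refine Finset.sum_congr rfl fun x _ => ?_
  congr 2
  funext i
  simp

theorem projMatrix_of_isEmpty [IsEmpty ι] (I J : ι → Fin n) : projMatrix I J = 1 := by
  symm
  refine eq_projMatrix (q := fun _ => 1) ?_ J (fun u hu => ?_) I
  · refine (minimal_isContractionClosed n).mem_indexed_of_equiv (Equiv.equivOfIsEmpty (Fin 0) ι) ?_
    exact (minimal_isContractionClosed n).one_mem
  · simp [Subsingleton.elim default J]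

/-- Extension of a colouring by two colours. -/
def consPair (a b : Fin n) (I : ι → Fin n) (o : Option (Option ι)) : Fin n :=
  o.elim a fun o' => o'.elim b I

theorem sum_projMatrix_consPair (a b : Fin n) (I J : ι → Fin n) :
    ∑ c, projMatrix (consPair c c I) (consPair a b J) = if a = b then projMatrix I J else 0 := by
  have hU := minimal_isContractionClosed n
  have hmem := hU.indexed_contract (projMatrix_mem (consPair a b J))
  have hpair : ∀ u ∈ indexed (minimal n) ι,
      ∑ I, u I * ∑ c, projMatrix (consPair c c I) (consPair a b J) = if a = b then u J else 0 := by
    intro u hu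
    let E : Fin 2 ⊕ ι ≃ Option (Option ι) :=
      { toFun := Sum.elim ![none, some none] fun i => some (some i)
        invFun := fun o => o.elim (.inl 0) fun o' => o'.elim (.inl 1) .inr
        left_inv := by
          rintro (i | i)
          · fin_cases i <;> rfl
          · rfl
        right_inv := by rintro (_ | _ | i) <;> rfl }
    have h1 := sum_mul_projMatrix (indexed_reindex (hU.indexed_mul
      (hU.mem_indexed_fin hU.diag_mem) hu) E) (consPair a b J)
    simp only [← (Equiv.piOptionEquivProd (β := fun _ : Option (Option ι) => Fin n)).symm.sum_comp,
      ← (Equiv.piOptionEquivProd (β := fun _ : Option ι => Fin n)).symm.sum_comp,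
      Fintype.sum_prod_type] at h1
    have hp : ∀ (x y : Fin n) (z : ι → Fin n),
        (Equiv.piOptionEquivProd (β := fun _ : Option (Option ι) => Fin n)).symm
          (x, (Equiv.piOptionEquivProd (β := fun _ : Option ι => Fin n)).symm (y, z)) =
          consPair x y z := by
      intro x y z
      funext o
      rcases o with _ | _ | o <;> rfl
    have hE : ∀ (x y : Fin n) (z : ι → Fin n), ((consPair x y z ∘ E) ∘ Sum.inl) 0 = x ∧
        ((consPair x y z ∘ E) ∘ Sum.inl) 1 = y ∧ (consPair x y z ∘ E) ∘ Sum.inr = z :=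
      fun x y z => ⟨rfl, rfl, rfl⟩
    simp only [hp, (hE _ _ _).1, (hE _ _ _).2.1, (hE _ _ _).2.2, ite_mul, one_mul, zero_mul] at h1
    rw [← h1, Finset.sum_comm' (t' := Finset.univ) (s' := fun _ => Finset.univ) (by simp)]
    simp only [Finset.mul_sum]
    rw [Finset.sum_comm]
    refine Finset.sum_congr rfl fun x _ => ?_
    rw [Finset.sum_eq_single x]
    · simp
    · intro y _ hy
      simp [hy]
    · simp
  split_ifs with h
  · exact eq_projMatrix hmem J (fun u hu => (hpair u hu).trans (if_pos h)) I
  · refine eq_of_sub_eq_zero (congrFun (?_ : ((fun I : ι → Fin n =>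
      ∑ c, projMatrix (consPair c c I) (consPair a b J)) - 0 = 0)) I)
    rw [sub_zero, ← dotProduct_self_eq_zero]
    exact (hpair _ hmem).trans (if_neg h)

end

end IsContractionClosed

theorem exists_equiv_comp_eq_of_sum_single_eq {α ι κ : Type} [Fintype ι] [Fintype κ]
    {q : ι → α} {r : κ → α} (h : ∑ i, Finsupp.single (q i) 1 = ∑ i, (Finsupp.single (r i) 1 : α →₀ ℕ)) :
    ∃ e : ι ≃ κ, r ∘ e = q := by
  classical
  have hcard : ∀ c, Nonempty ({i // q i = c} ≃ {j // r j = c}) := fun c => by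
    rw [← Fintype.card_eq]
    have := DFunLike.congr_fun h c
    simpa [Finsupp.single_apply, Fintype.card_subtype] using this
  exact ⟨Equiv.ofFiberEquiv fun c => (hcard c).some,
    funext fun i => Equiv.ofFiberEquiv_map _ i⟩

theorem Finsupp.sum_sigma_single {α : Type} [Fintype α] (m : α →₀ ℕ) :
    ∑ i : Σ a, Fin (m a), Finsupp.single i.1 1 = m := by
  rw [Fintype.sum_sigma]
  simp

theorem MvPolynomial.prod_X_eq_monomial {α ι R : Type} [CommSemiring R] [Fintype ι] (q : ι → α) :
    ∏ i, (X (q i) : MvPolynomial α R) = monomial (∑ i, Finsupp.single (q i) 1) 1 := by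
  rw [monomial_sum_one]
  rfl

namespace IsContractionClosed

variable {n : ℕ}

/-- The functional on polynomials in the entries of an `n × n` matrix that sends the matrix
coefficients of `V^{⊗ k}` to those of the projection onto the minimal contraction-closed family. -/
noncomputable def haar (F : Type) [Field F] (n : ℕ) : MvPolynomial (Fin n × Fin n) F →ₗ[F] F := by
  classical
  exact (basisMonomials (Fin n × Fin n) F).constr F fun m =>
    ((projMatrix (fun i : Σ a, Fin (m a) => i.1.1) fun i => i.1.2 : ℚ) : F)

variable {F : Type} [Field F]

theorem haar_prod_X {ι : Type} [Fintype ι] [DecidableEq ι] (I J : ι → Fin n) :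
    haar F n (∏ i, X (I i, J i)) = (projMatrix I J : ℚ) := by
  classical
  rw [prod_X_eq_monomial fun i => (I i, J i), haar]
  refine (congrArg _ (congrFun (coe_basisMonomials _ F).symm _)).trans ?_
  rw [Module.Basis.constr_basis]
  obtain ⟨e, he⟩ := exists_equiv_comp_eq_of_sum_single_eq (Finsupp.sum_sigma_single
    (∑ i, Finsupp.single (I i, J i) 1)).symm
  rw [← projMatrix_comp e]
  congr 2
  · funext i
    exact congrArg Prod.fst (congrFun he i)
  · funext i
    exact congrArg Prod.snd (congrFun he i)

theorem exists_monomial_eq_prod_X (m : Fin n × Fin n →₀ ℕ) : ∃ (d : ℕ) (I J : Fin d → Fin n),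
    (monomial m 1 : MvPolynomial (Fin n × Fin n) F) = ∏ i, X (I i, J i) := by
  let e := Fintype.equivFin (Σ a, Fin (m a))
  refine ⟨_, fun i => (e.symm i).1.1, fun i => (e.symm i).1.2, ?_⟩
  rw [prod_X_eq_monomial fun i => ((e.symm i).1.1, (e.symm i).1.2)]
  congr 1
  rw [← e.sum_comp]
  simp only [Equiv.symm_apply_apply, Prod.mk.eta, Finsupp.sum_sigma_single]

theorem linearMap_ext_prod_X {M : Type} [AddCommMonoid M] [Module F M]
    {f g : MvPolynomial (Fin n × Fin n) F →ₗ[F] M}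
    (h : ∀ (d : ℕ) (I J : Fin d → Fin n), f (∏ i, X (I i, J i)) = g (∏ i, X (I i, J i))) :
    f = g := by
  refine (basisMonomials (Fin n × Fin n) F).ext fun m => ?_
  obtain ⟨d, I, J, hm⟩ := exists_monomial_eq_prod_X (F := F) m
  simp only [coe_basisMonomials]
  rw [hm, h]

theorem haar_one : haar F n 1 = 1 := by
  have := haar_prod_X (F := F) (n := n) (ι := Fin 0) Fin.elim0 Fin.elim0
  rwa [projMatrix_of_isEmpty, Finset.univ_eq_empty, Finset.prod_empty, Rat.cast_one] at this

theorem haar_prod_X_mem [CharZero F] {A : ∀ k : ℕ, Submodule F (Tensor F n k)}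
    (hA : IsContractionClosed A) {ι : Type} [Fintype ι] (I : ι → Fin n) :
    (fun J : ι → Fin n => haar F n (∏ i, X (I i, J i))) ∈ indexed A ι := by
  classical
  simp only [haar_prod_X]
  intro k e
  exact mem_minimal.1 (by simpa only [projMatrix_comm I] using projMatrix_mem I k e) _
    (rationalPoints_isContractionClosed hA)

theorem haar_eq_zero_of_mem_orthIdeal [CharZero F] {f : MvPolynomial (Fin n × Fin n) F}
    (hf : f ∈ orthIdeal F n) : haar F n f = 0 := by
  suffices h : ∀ (q : Fin n × Fin n) (a : MvPolynomial (Fin n × Fin n) F),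
      haar F n (a * ((genericMatrix F n).transpose * genericMatrix F n - 1) q.1 q.2) = 0 by
    obtain ⟨c, rfl⟩ := Ideal.mem_span_range_iff_exists_fun.1 hf
    rw [map_sum]
    exact Finset.sum_eq_zero fun q _ => h q (c q)
  rintro ⟨a, b⟩ f
  have key : (haar F n).comp (LinearMap.mulRight F
      (((genericMatrix F n).transpose * genericMatrix F n - 1) a b)) = 0 := by
    refine linearMap_ext_prod_X fun d I J => ?_
    have h1 : ∀ c, (∏ i, X (I i, J i)) * (X (c, a) * X (c, b)) =
        (∏ i, X (consPair c c I i, consPair a b J i) : MvPolynomial (Fin n × Fin n) F) := by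
      intro c
      simp only [Fintype.prod_option]
      simp only [consPair, Option.elim]
      ring
    rw [LinearMap.comp_apply, LinearMap.mulRight_apply, Matrix.sub_apply, mul_sub, map_sub,
      Matrix.mul_apply, Finset.mul_sum, map_sum]
    simp only [Matrix.transpose_apply, genericMatrix, Matrix.of_apply, h1, haar_prod_X]
    rw [← Rat.cast_sum, sum_projMatrix_consPair, Matrix.one_apply]
    split_ifs <;> simp [haar_prod_X]
  exact LinearMap.congr_fun key f

theorem haar_mul_right [CharZero F] {A : ∀ k : ℕ, Submodule F (Tensor F n k)}
    (hA : IsContractionClosed A) {h : Matrix (Fin n) (Fin n) F}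
    (hh : ∀ k, ∀ a ∈ A k, tact h.transpose k a = a) (f : MvPolynomial (Fin n × Fin n) F) :
    haar F n (evalMat (genericMatrix F n * h.map (algebraMap F _)) f) = haar F n f := by
  suffices key : (haar F n).comp
      (evalMat (F := F) (genericMatrix F n * h.map (algebraMap F _))).toLinearMap = haar F n from
    LinearMap.congr_fun key f
  refine linearMap_ext_prod_X fun d I J => ?_
  have hm := congrFun (hh d _ (mem_of_mem_indexed_fin (haar_prod_X_mem hA I))) J
  rw [← hm]
  simp only [evalMat, genericMatrix, LinearMap.comp_apply, AlgHom.toLinearMap_apply, map_prod,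
    aeval_X, Matrix.mul_apply, Matrix.of_apply, Matrix.map_apply, Finset.prod_univ_sum, tact,
    Matrix.mulVecLin_apply, Matrix.mulVec, dotProduct, Fintype.piFinset_univ, map_sum,
    Matrix.transpose_apply]
  refine Finset.sum_congr rfl fun K _ => ?_
  rw [Finset.prod_mul_distrib, ← map_prod, mul_comm, ← Algebra.smul_def, map_smul, smul_eq_mul]

end IsContractionClosed

open scoped TensorProduct

section RelativeAverage

variable {F S R : Type} [Field F] [CharZero F] [CommRing S] [CommRing R] [Algebra F S] [Algebra S R]
  [Algebra.FiniteType S R] [IsReduced R] [Nontrivial R] [IsNoetherianRing R]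

theorem exists_smul_eq_algebraMap_of_isNilpotent (F : Type) [Field F] [CharZero F] [Algebra F S]
    (hinj : Function.Injective (algebraMap S R)) {ι : Type} [Finite ι] (f : ι → R)
    (h : ∀ i, IsNilpotent (f i ⊗ₜ[S] (1 : R) - 1 ⊗ₜ f i)) :
    ∃ s : S, s ≠ 0 ∧ ∀ i, ∃ t : S, s • f i = algebraMap S R t := by
  obtain ⟨p, hp, ℓ, hℓ, hnil⟩ := exists_prime_functional_lTensor_eq_zero (F := F) hinj
  obtain ⟨s₁, hs₁, hker⟩ := exists_smul_eq_zero_of_tmul_one_eq_zero (R := R) p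
  have := Fintype.ofFinite ι
  obtain ⟨s, hs⟩ := IsLocalization.exist_integer_multiples_of_finite p.primeCompl fun i => ℓ (f i)
  refine ⟨s₁ * s, fun h0 => ?_, fun i => ?_⟩
  · exact (p.primeCompl.mul_mem hs₁ s.2) (h0 ▸ p.zero_mem)
  obtain ⟨t, ht⟩ := hs i
  refine ⟨s₁ * t, ?_⟩
  have h1 := hnil _ (h i)
  rw [map_sub, LinearMap.lTensor_tmul, LinearMap.lTensor_tmul, hℓ, sub_eq_zero] at h1
  have h2 := hker ((s : S) • f i - algebraMap S R t) (by
    rw [TensorProduct.sub_tmul, ← TensorProduct.smul_tmul', h1, ← TensorProduct.tmul_smul, ← ht,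
      Algebra.algebraMap_eq_smul_one t, Algebra.algebraMap_eq_smul_one t, TensorProduct.smul_tmul,
      sub_self])
  rw [smul_sub, sub_eq_zero, ← mul_smul] at h2
  rw [h2, map_mul, Algebra.smul_def]

theorem exists_relative_average (F : Type) [Field F] [CharZero F] [Algebra F S]
    (hinj : Function.Injective (algebraMap S R)) {ι : Type} [Fintype ι] (z : ι → R ⊗[S] R) :
    ∃ (s : S) (Y : ι → R), s ≠ 0 ∧
      (∀ (c : ι → R) (r : R), IsNilpotent (∑ i, c i • z i - r ⊗ₜ 1) → ∑ i, c i * Y i = s • r) ∧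
      ∀ (τ : R →ₗ[S] R) (i : ι) (c : ι → R), IsNilpotent (τ.rTensor R (z i) - ∑ j, c j • z j) →
        τ (Y i) = ∑ j, c j * Y j := by
  obtain ⟨p, hp, ℓ, hℓ, hnil⟩ := exists_prime_functional_lTensor_eq_zero (F := F) hinj
  obtain ⟨s₁, hs₁, hker⟩ := exists_smul_eq_zero_of_tmul_one_eq_zero (R := R) p
  obtain ⟨s, hs, hY⟩ := exists_smul_eq_tmul_one p fun i => ℓ.lTensor R (z i)
  choose Y hY using hY
  have hlin : ∀ (c : R) (z : R ⊗[S] R), ℓ.lTensor R (c • z) = c • ℓ.lTensor R z := by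
    intro c z
    induction z with
    | zero => simp
    | add x y hx hy => simp only [smul_add, map_add, hx, hy]
    | tmul x y => simp [TensorProduct.smul_tmul']
  have hcomb : ∀ c : ι → R, s • ℓ.lTensor R (∑ i, c i • z i) = (∑ i, c i * Y i) ⊗ₜ 1 := by
    intro c
    rw [map_sum, Finset.smul_sum, TensorProduct.sum_tmul]
    refine Finset.sum_congr rfl fun i _ => ?_
    rw [hlin, smul_comm, hY, TensorProduct.smul_tmul', smul_eq_mul]
  refine ⟨s₁ * s, fun i => s₁ • Y i, fun h0 => ?_, fun c r h => ?_, fun τ i c h => ?_⟩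
  · exact (p.primeCompl.mul_mem hs₁ hs) (h0 ▸ p.zero_mem)
  · have h1 := hnil _ h
    rw [map_sub, LinearMap.lTensor_tmul, hℓ, sub_eq_zero] at h1
    have h2 := hker (∑ i, c i * Y i - s • r) (by
      rw [TensorProduct.sub_tmul, ← TensorProduct.smul_tmul', ← hcomb, h1, sub_self])
    rw [smul_sub, sub_eq_zero, ← mul_smul] at h2
    rw [← h2, Finset.smul_sum]
    exact Finset.sum_congr rfl fun i _ => mul_smul_comm _ _ _
  · have h1 := hnil _ h
    rw [map_sub, sub_eq_zero] at h1
    have h3 : ℓ.lTensor R (τ.rTensor R (z i)) = τ.rTensor _ (ℓ.lTensor R (z i)) := by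
      rw [← LinearMap.comp_apply, ← LinearMap.comp_apply, LinearMap.lTensor_comp_rTensor,
        LinearMap.rTensor_comp_lTensor]
    have h2 := hker (τ (Y i) - ∑ j, c j * Y j) (by
      rw [TensorProduct.sub_tmul, ← hcomb, ← h1, h3, ← LinearMap.rTensor_tmul, ← hY, map_smul,
        sub_self])
    rw [smul_sub, sub_eq_zero] at h2
    rw [map_smul, h2, Finset.smul_sum]
    exact Finset.sum_congr rfl fun i _ => (mul_smul_comm _ _ _).symm

end RelativeAverage

theorem isNilpotent_of_forall_algHom_eq_zero {F B : Type} [Field F] [IsAlgClosed F] [CommRing B]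
    [Algebra F B] [Algebra.FiniteType F B] {z : B} (h : ∀ χ : B →ₐ[F] F, χ z = 0) :
    IsNilpotent z := by
  have : IsJacobsonRing B := isJacobsonRing_of_finiteType (A := F)
  rw [← mem_nilradical, nilradical, Ideal.radical_eq_jacobson, Ideal.jacobson, Ideal.mem_sInf]
  rintro m ⟨-, hm⟩
  let := Ideal.Quotient.field m
  have : Algebra.FiniteType F (B ⧸ m) := inferInstance
  have := finite_of_finite_type_of_isJacobsonRing F (B ⧸ m)
  let e : F ≃ₐ[F] (B ⧸ m) := AlgEquiv.ofBijective (Algebra.ofId F (B ⧸ m))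
    (IsAlgClosed.algebraMap_bijective_of_isIntegral)
  have h1 := h ((e.symm : (B ⧸ m) →ₐ[F] F).comp (Ideal.Quotient.mkₐ F m))
  exact Ideal.Quotient.eq_zero_iff_mem.1 ((EmbeddingLike.map_eq_zero_iff (f := e.symm)).1 h1)

section TensorAction

variable {K : Type} [Field K] {n : ℕ}

theorem tact_apply (g : Matrix (Fin n) (Fin n) K) (k : ℕ) (t : Tensor K n k) (φ : Fin k → Fin n) :
    tact g k t φ = ∑ ψ, (∏ i, g (φ i) (ψ i)) * t ψ := rfl

theorem tact_one (k : ℕ) (t : Tensor K n k) : tact 1 k t = t := by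
  funext φ
  rw [tact_apply, Finset.sum_eq_single φ]
  · simp
  · intro ψ _ hψ
    obtain ⟨i, hi⟩ := Function.ne_iff.1 hψ
    have h : (1 : Matrix (Fin n) (Fin n) K) (φ i) (ψ i) = 0 := Matrix.one_apply_ne hi.symm
    have h' : ∏ j, (1 : Matrix (Fin n) (Fin n) K) (φ j) (ψ j) = 0 :=
      Finset.prod_eq_zero (Finset.mem_univ i) h
    simp only [h', zero_mul]
  · simp

theorem tact_mul (g h : Matrix (Fin n) (Fin n) K) (k : ℕ) (t : Tensor K n k) :
    tact (g * h) k t = tact g k (tact h k t) := by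
  funext φ
  simp only [tact_apply, Matrix.mul_apply, Finset.prod_univ_sum, Fintype.piFinset_univ,
    Finset.sum_mul, Finset.mul_sum]
  rw [Finset.sum_comm]
  refine Finset.sum_congr rfl fun ψ _ => Finset.sum_congr rfl fun χ _ => ?_
  rw [Finset.prod_mul_distrib, mul_assoc]

theorem mul_mem_orthSet {g h : Matrix (Fin n) (Fin n) K} (hg : g ∈ orthSet K n)
    (hh : h ∈ orthSet K n) : g * h ∈ orthSet K n := by
  simp only [orthSet, Set.mem_ofPred_eq] at *
  rw [Matrix.transpose_mul, Matrix.mul_assoc, ← Matrix.mul_assoc g.transpose, hg, Matrix.one_mul, hh]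

theorem transpose_mem_orthSet {g : Matrix (Fin n) (Fin n) K} (hg : g ∈ orthSet K n) :
    g.transpose ∈ orthSet K n := by
  simp only [orthSet, Set.mem_ofPred_eq, Matrix.transpose_transpose] at *
  exact mul_eq_one_comm.1 hg

theorem one_mem_orthSet : (1 : Matrix (Fin n) (Fin n) K) ∈ orthSet K n := by
  simp [orthSet]

theorem transpose_mem_setStab {A : ∀ k : ℕ, Submodule K (Tensor K n k)}
    {g : Matrix (Fin n) (Fin n) K} (hg : g ∈ setStab A) : g.transpose ∈ setStab A := by
  refine ⟨transpose_mem_orthSet hg.1, fun k a ha => ?_⟩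
  have h := hg.2 k a ha
  conv_lhs => rw [← h, ← tact_mul, show g.transpose * g = 1 from hg.1, tact_one]

end TensorAction

section Orbit

variable {F : Type} [Field F] {n : ℕ} (e : ℕ) (w : ∀ k : ℕ, Tensor F n k)

/-- The coordinates of `⊕_{k ≤ e} V^{⊗ k}`. -/
abbrev TupleIndex (e n : ℕ) : Type := Σ p : Fin (e + 1), (Fin p.1 → Fin n)

/-- The coordinates of the translate of `w` by the generic matrix. -/
noncomputable def orbitPoly (q : TupleIndex e n) : MvPolynomial (Fin n × Fin n) F :=
  ∑ ψ, (∏ i, X (q.2 i, ψ i)) * C (w q.1 ψ)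

/-- The coordinates of `g w`. -/
def orbitPoint (g : Matrix (Fin n) (Fin n) F) (q : TupleIndex e n) : F :=
  tact g q.1 (w q.1) q.2

theorem evalMat_orbitPoly (g : Matrix (Fin n) (Fin n) F) (q : TupleIndex e n) :
    evalMat g (orbitPoly e w q) = orbitPoint e w g q := by
  simp [orbitPoly, orbitPoint, evalMat, tact_apply]

theorem exists_translate (p : MvPolynomial (TupleIndex e n) F) (g₀ : Matrix (Fin n) (Fin n) F) :
    ∃ p' : MvPolynomial (TupleIndex e n) F, ∀ g,
      eval (orbitPoint e w g) p' = eval (orbitPoint e w (g₀ * g)) p := by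
  refine ⟨aeval (fun q : TupleIndex e n =>
    ∑ ψ, C (∏ i, g₀ (q.2 i) (ψ i)) * X (⟨q.1, ψ⟩ : TupleIndex e n)) p, fun g => ?_⟩
  simp only [← aeval_eq_eval]
  rw [← AlgHom.comp_apply, comp_aeval]
  congr 2
  funext q
  simp [orbitPoint, tact_mul, tact_apply g₀]

theorem one_mem_of_translate [IsAlgClosed F] (horb : IsZarClosed (tensorTupleOrbit e w))
    {I : Ideal (MvPolynomial (TupleIndex e n) F)}
    (hI : ∀ p, (∀ g ∈ orthSet F n, eval (orbitPoint e w g) p = 0) → p ∈ I)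
    (htrans : ∀ p ∈ I, ∀ g₀ ∈ orthSet F n, ∀ p', (∀ g ∈ orthSet F n,
      eval (orbitPoint e w g) p' = eval (orbitPoint e w (g₀ * g)) p) → p' ∈ I)
    {p : MvPolynomial (TupleIndex e n) F} (hp : p ∈ I) {g₁ : Matrix (Fin n) (Fin n) F}
    (hg₁ : g₁ ∈ orthSet F n) (hne : eval (orbitPoint e w g₁) p ≠ 0) : 1 ∈ I := by
  have hempty : zeroLocus F I = ∅ := by
    refine Set.eq_empty_of_forall_notMem fun x hx => ?_
    rw [mem_zeroLocus_iff] at hx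
    replace hx : ∀ p ∈ I, eval x p = 0 := fun p hp => by rw [← aeval_eq_eval]; exact hx p hp
    obtain ⟨P, hP⟩ := horb
    by_cases hxo : x ∈ tensorTupleOrbit e w
    · obtain ⟨g, hg, hxg⟩ := hxo
      obtain ⟨p', hp'⟩ := exists_translate e w p (g₁ * g.transpose)
      have := hx p' (htrans p hp (g₁ * g.transpose)
        (mul_mem_orthSet hg₁ (transpose_mem_orthSet hg)) p' fun g _ => hp' g)
      obtain rfl : x = orbitPoint e w g := funext hxg
      rw [hp', Matrix.mul_assoc, show g.transpose * g = 1 from hg, Matrix.mul_one] at this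
      exact hne this
    · have hxo' := hxo
      rw [hP] at hxo
      simp only [Set.mem_ofPred_eq, not_forall] at hxo
      obtain ⟨p, hpP, hpx⟩ := hxo
      refine hpx (hx p (hI p fun g hg => ?_))
      have : orbitPoint e w g ∈ tensorTupleOrbit e w := ⟨g, hg, fun q => rfl⟩
      rw [hP] at this
      exact this p hpP
  have h := vanishingIdeal_zeroLocus_eq_radical (k := F) (K := F) I
  rw [hempty, vanishingIdeal_empty, eq_comm, Ideal.radical_eq_top] at h
  rw [h]
  trivial

end Orbit

section CoordinateRing

variable {F : Type} [Field F] {n : ℕ} {R : Type} [CommRing R] [Algebra F R]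

instance {S : Subalgebra F R} [Algebra.FiniteType F R] : Algebra.FiniteType F (R ⊗[S] R) :=
  have : Algebra.FiniteType S R := Algebra.FiniteType.of_restrictScalars_finiteType F _ _
  Algebra.FiniteType.trans (S := R) inferInstance inferInstance

theorem map_eq_map_iff_of_ker_eq_orthIdeal [IsAlgClosed F] [CharZero F]
    {mk : MvPolynomial (Fin n × Fin n) F →ₐ[F] R} (hmk : RingHom.ker mk = orthIdeal F n)
    {p q : MvPolynomial (Fin n × Fin n) F} :
    mk p = mk q ↔ ∀ g ∈ orthSet F n, evalMat g p = evalMat g q := by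
  rw [← sub_eq_zero, ← map_sub, ← RingHom.mem_ker, hmk]
  refine ⟨fun h g hg => ?_, fun h => ?_⟩
  · rw [← sub_eq_zero, ← map_sub]
    exact evalMat_eq_zero_of_mem_orthIdeal hg h
  · refine mem_orthIdeal_of_forall_evalMat_eq_zero fun g hg => ?_
    rw [map_sub, h g hg, sub_self]

theorem isReduced_of_ker_eq_orthIdeal [IsAlgClosed F] [CharZero F]
    {mk : MvPolynomial (Fin n × Fin n) F →ₐ[F] R} (hmk : RingHom.ker mk = orthIdeal F n)
    (hsurj : Function.Surjective mk) : IsReduced R := by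
  refine ⟨fun x ⟨k, hk⟩ => ?_⟩
  obtain ⟨p, rfl⟩ := hsurj x
  rw [← map_pow, ← map_zero mk, map_eq_map_iff_of_ker_eq_orthIdeal hmk] at hk
  rw [← map_zero mk, map_eq_map_iff_of_ker_eq_orthIdeal hmk]
  intro g hg
  have := hk g hg
  rw [map_pow, map_zero] at this
  rw [map_zero]
  exact eq_zero_of_pow_eq_zero this

theorem nontrivial_of_ker_eq_orthIdeal [IsAlgClosed F] [CharZero F]
    {mk : MvPolynomial (Fin n × Fin n) F →ₐ[F] R} (hmk : RingHom.ker mk = orthIdeal F n) :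
    Nontrivial R := by
  refine ⟨⟨mk 1, mk 0, fun h => ?_⟩⟩
  have := (map_eq_map_iff_of_ker_eq_orthIdeal hmk).1 h 1 one_mem_orthSet
  simp at this

theorem exists_eq_evalMat_of_ker_eq_orthIdeal
    {mk : MvPolynomial (Fin n × Fin n) F →ₐ[F] R} (hmk : RingHom.ker mk = orthIdeal F n)
    (f : R →ₐ[F] F) : ∃ g ∈ orthSet F n, ∀ p, f (mk p) = evalMat g p := by
  have hfg : ∀ p, f (mk p) = evalMat ((genericMatrix F n).map (f.comp mk)) p := fun p => by
    have : f.comp mk = evalMat ((genericMatrix F n).map (f.comp mk)) := by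
      ext q
      simp [evalMat, genericMatrix]
    exact DFunLike.congr_fun this p
  refine ⟨_, ?_, hfg⟩
  have h1 : ((genericMatrix F n).transpose * genericMatrix F n - 1).map (f.comp mk) = 0 := by
    ext i j
    have : ((genericMatrix F n).transpose * genericMatrix F n - 1) i j ∈ RingHom.ker mk := by
      rw [hmk]
      exact Ideal.subset_span ⟨(i, j), rfl⟩
    rw [RingHom.mem_ker] at this
    rw [Matrix.map_apply, AlgHom.comp_apply, this, map_zero, Matrix.zero_apply]
  rw [Matrix.map_sub _ (map_sub _), Matrix.map_mul, Matrix.map_one _ (map_zero _) (map_one _),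
    Matrix.transpose_map, sub_eq_zero] at h1
  exact h1

/-- The algebra of functions that factor through the orbit map of `w`. -/
noncomputable def orbitSubalgebra (mk : MvPolynomial (Fin n × Fin n) F →ₐ[F] R) (e : ℕ)
    (w : ∀ k : ℕ, Tensor F n k) : Subalgebra F R :=
  (aeval fun q => mk (orbitPoly e w q) : MvPolynomial (TupleIndex e n) F →ₐ[F] R).range

variable {mk : MvPolynomial (Fin n × Fin n) F →ₐ[F] R} {e : ℕ} {w : ∀ k : ℕ, Tensor F n k}

theorem exists_orbitSubalgebra_eq (s : orbitSubalgebra mk e w) :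
    ∃ (t : MvPolynomial (TupleIndex e n) F) (p : MvPolynomial (Fin n × Fin n) F),
      (s : R) = mk p ∧ ∀ g, evalMat g p = eval (orbitPoint e w g) t := by
  obtain ⟨s, t, rfl⟩ := s
  refine ⟨t, aeval (orbitPoly e w) t, ?_, fun g => ?_⟩
  · rw [← AlgHom.comp_apply, comp_aeval]
    rfl
  · rw [← AlgHom.comp_apply, comp_aeval, ← aeval_eq_eval]
    simp only [evalMat_orbitPoly]

theorem isNilpotent_of_orbit [IsAlgClosed F] [Algebra.FiniteType F R]
    (hmk : RingHom.ker mk = orthIdeal F n) (hw : ∀ k, e < k → w k = 0)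
    {z : R ⊗[orbitSubalgebra mk e w] R}
    (h : ∀ χ : R ⊗[orbitSubalgebra mk e w] R →ₐ[F] F, ∀ g ∈ orthSet F n,
      ∀ h ∈ orthSet F n, (∀ k, tact h k (w k) = w k) →
      (∀ p, χ (mk p ⊗ₜ 1) = evalMat g p) → (∀ p, χ (1 ⊗ₜ mk p) = evalMat (g * h) p) →
      χ z = 0) : IsNilpotent z := by
  refine isNilpotent_of_forall_algHom_eq_zero (F := F) fun χ => ?_
  obtain ⟨g, hg, hχ⟩ := exists_eq_evalMat_of_ker_eq_orthIdeal hmk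
    (χ.comp (Algebra.TensorProduct.includeLeft))
  obtain ⟨g', hg', hχ'⟩ := exists_eq_evalMat_of_ker_eq_orthIdeal hmk (χ.comp
    ((Algebra.TensorProduct.includeRight (R := orbitSubalgebra mk e w)).restrictScalars F))
  have hgg' : g * (g.transpose * g') = g' := by
    rw [← Matrix.mul_assoc, mul_eq_one_comm.1 (show g.transpose * g = 1 from hg), Matrix.one_mul]
  refine h χ g hg (g.transpose * g') (mul_mem_orthSet (transpose_mem_orthSet hg) hg') (fun k => ?_)
    hχ fun p => by rw [hgg']; exact hχ' p
  rcases lt_or_ge e k with hk | hk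
  · rw [hw k hk, map_zero]
  have hpt : tact g' k (w k) = tact g k (w k) := by
    funext φ
    let q : TupleIndex e n := ⟨⟨k, Nat.lt_succ_of_le hk⟩, φ⟩
    change orbitPoint e w g' q = orbitPoint e w g q
    let s : orbitSubalgebra mk e w := ⟨mk (orbitPoly e w q), X q, by simp⟩
    have hs : (mk (orbitPoly e w q)) ⊗ₜ[orbitSubalgebra mk e w] (1 : R)
        = 1 ⊗ₜ mk (orbitPoly e w q) := by
      have := TensorProduct.smul_tmul (R := orbitSubalgebra mk e w) s (1 : R) (1 : R)
      simpa [s, Algebra.smul_def] using this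
    rw [← evalMat_orbitPoly, ← evalMat_orbitPoly, ← hχ, ← hχ']
    exact (congrArg χ hs).symm
  rw [tact_mul, hpt, ← tact_mul, show g.transpose * g = 1 from hg, tact_one]

theorem exists_evalMat_ne_zero [IsAlgClosed F] [CharZero F]
    (hmk : RingHom.ker mk = orthIdeal F n) {p : MvPolynomial (Fin n × Fin n) F}
    (h : mk p ≠ 0) : ∃ g ∈ orthSet F n, evalMat g p ≠ 0 := by
  by_contra! h'
  refine h ?_
  rw [← map_zero mk, map_eq_map_iff_of_ker_eq_orthIdeal hmk]
  intro g hg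
  rw [h' g hg, map_zero]

end CoordinateRing

section OrbitDenominator

variable {F : Type} [Field F] [IsAlgClosed F] [CharZero F] {n e : ℕ} {w : ∀ k : ℕ, Tensor F n k}

theorem exists_orbit_denominator (hw : ∀ k, e < k → w k = 0) {ι : Type} [Finite ι]
    (f : ι → MvPolynomial (Fin n × Fin n) F)
    (hf : ∀ i, ∀ g ∈ orthSet F n, ∀ h ∈ orthSet F n, (∀ k, tact h k (w k) = w k) →
      evalMat (g * h) (f i) = evalMat g (f i)) :
    ∃ s : MvPolynomial (TupleIndex e n) F,
      (∃ g ∈ orthSet F n, eval (orbitPoint e w g) s ≠ 0) ∧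
      ∀ i, ∃ t : MvPolynomial (TupleIndex e n) F, ∀ g ∈ orthSet F n,
        eval (orbitPoint e w g) s * evalMat g (f i) = eval (orbitPoint e w g) t := by
  obtain ⟨R, _, _, _, mk, hmk, hsurj⟩ : ∃ (R : Type) (_ : CommRing R) (_ : Algebra F R)
      (_ : Algebra.FiniteType F R) (mk : MvPolynomial (Fin n × Fin n) F →ₐ[F] R),
      RingHom.ker mk = orthIdeal F n ∧ Function.Surjective mk :=
    ⟨_, _, _, inferInstance, Ideal.Quotient.mkₐ F (orthIdeal F n), Ideal.Quotient.mkₐ_ker F _,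
      Ideal.Quotient.mkₐ_surjective F _⟩
  have := isReduced_of_ker_eq_orthIdeal hmk hsurj
  have := nontrivial_of_ker_eq_orthIdeal hmk
  have : IsNoetherianRing R := Algebra.FiniteType.isNoetherianRing F R
  have : Algebra.FiniteType (orbitSubalgebra mk e w) R :=
    Algebra.FiniteType.of_restrictScalars_finiteType F _ _
  obtain ⟨s, hs, hst⟩ := exists_smul_eq_algebraMap_of_isNilpotent (S := orbitSubalgebra mk e w) F
    Subtype.val_injective (fun i => mk (f i)) fun i =>
      isNilpotent_of_orbit hmk hw fun χ g hg h hh hhw h1 h2 => by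
        rw [map_sub, h1, h2, hf i g hg h hh hhw, sub_self]
  obtain ⟨s', p, hp, hps⟩ := exists_orbitSubalgebra_eq s
  refine ⟨s', ?_, fun i => ?_⟩
  · obtain ⟨g, hg, hne⟩ := exists_evalMat_ne_zero hmk (p := p) (hp ▸ fun h => hs (Subtype.ext h))
    exact ⟨g, hg, hps g ▸ hne⟩
  · obtain ⟨t, ht⟩ := hst i
    obtain ⟨t', q, hq, hqt⟩ := exists_orbitSubalgebra_eq t
    refine ⟨t', fun g hg => ?_⟩
    rw [Algebra.smul_def, Subalgebra.algebraMap_def, Subalgebra.algebraMap_def, hp, hq,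
      Algebra.algebraMap_self_apply, Algebra.algebraMap_self_apply,
      ← map_mul, map_eq_map_iff_of_ker_eq_orthIdeal hmk] at ht
    rw [← hps, ← hqt, ← map_mul, ht g hg]

end OrbitDenominator

section RelativeProjection

variable {F : Type} [Field F] {n : ℕ} {R : Type} [CommRing R] [Algebra F R]
  {mk : MvPolynomial (Fin n × Fin n) F →ₐ[F] R} {e : ℕ} {w : ∀ k : ℕ, Tensor F n k}

theorem evalMat_evalMat_mul (g h : Matrix (Fin n) (Fin n) F) (p : MvPolynomial (Fin n × Fin n) F) :
    evalMat g (evalMat (genericMatrix F n * h.map (algebraMap F _)) p) = evalMat (g * h) p := by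
  rw [evalMat_comp_evalMat, Matrix.map_mul, map_evalMat_genericMatrix, Matrix.map_map]
  have : (⇑(evalMat (F := F) g) ∘ ⇑(algebraMap F (MvPolynomial (Fin n × Fin n) F))) = id :=
    funext (evalMat (F := F) g).commutes
  rw [this, Matrix.map_id]

theorem exists_right_translation [IsAlgClosed F] [CharZero F]
    (hmk : RingHom.ker mk = orthIdeal F n) (hsurj : Function.Surjective mk)
    {h : Matrix (Fin n) (Fin n) F} (hh : h ∈ orthSet F n) (hhw : ∀ k, tact h k (w k) = w k) :
    ∃ τ : R →ₐ[orbitSubalgebra mk e w] R, ∀ p,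
      τ (mk p) = mk (evalMat (genericMatrix F n * h.map (algebraMap F _)) p) := by
  have hev := evalMat_evalMat_mul (F := F) (h := h)
  let T : MvPolynomial (Fin n × Fin n) F →ₐ[F] R :=
    mk.comp (evalMat (genericMatrix F n * h.map (algebraMap F _)))
  have hT : RingHom.ker mk ≤ RingHom.ker T := by
    intro p hp
    have h1 : ∀ g ∈ orthSet F n, evalMat g p = evalMat g 0 :=
      (map_eq_map_iff_of_ker_eq_orthIdeal hmk).1 ((RingHom.mem_ker.1 hp).trans (map_zero mk).symm)
    refine Eq.trans (b := mk 0) ?_ (map_zero mk)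
    change mk (evalMat _ p) = _
    refine (map_eq_map_iff_of_ker_eq_orthIdeal hmk).2 fun g hg => ?_
    rw [hev, h1 _ (mul_mem_orthSet hg hh), map_zero, map_zero]
  let τ : R →+* R := RingHom.liftOfSurjective mk.toRingHom hsurj ⟨T.toRingHom, hT⟩
  have hτ : ∀ p, τ (mk p) = mk (evalMat (genericMatrix F n * h.map (algebraMap F _)) p) :=
    fun p => RingHom.liftOfRightInverse_comp_apply mk.toRingHom _ _ ⟨T.toRingHom, hT⟩ p
  refine ⟨{ τ with commutes' := fun s => ?_ }, hτ⟩
  obtain ⟨t, p, hp, hpt⟩ := exists_orbitSubalgebra_eq s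
  change τ (s : R) = s
  rw [hp, hτ]
  refine (map_eq_map_iff_of_ker_eq_orthIdeal hmk).2 fun g hg => ?_
  rw [hev, hpt, hpt]
  congr 2
  funext q
  rw [orbitPoint, tact_mul, hhw, orbitPoint]

/-- The matrix of the functions `(g, g') ↦ gᵀ * g'`. -/
noncomputable def relativeMatrix (mk : MvPolynomial (Fin n × Fin n) F →ₐ[F] R)
    (S : Subalgebra F R) : Matrix (Fin n) (Fin n) (R ⊗[S] R) :=
  ((genericMatrix F n).map fun p => mk p ⊗ₜ 1).transpose * (genericMatrix F n).map fun p => 1 ⊗ₜ mk p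

theorem algHom_evalMat_relativeMatrix {S : Subalgebra F R} (χ : R ⊗[S] R →ₐ[F] F)
    {g g' : Matrix (Fin n) (Fin n) F} (h1 : ∀ p, χ (mk p ⊗ₜ 1) = evalMat g p)
    (h2 : ∀ p, χ (1 ⊗ₜ mk p) = evalMat g' p) (q : MvPolynomial (Fin n × Fin n) F) :
    χ (evalMat (relativeMatrix mk S) q) = evalMat (g.transpose * g') q := by
  rw [evalMat_comp_evalMat, relativeMatrix, Matrix.map_mul, Matrix.transpose_map, Matrix.map_map,
    Matrix.map_map]
  have e1 : (χ ∘ fun p => mk p ⊗ₜ[S] (1 : R)) = evalMat g := funext h1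
  have e2 : (χ ∘ fun p => (1 : R) ⊗ₜ[S] mk p) = evalMat g' := funext h2
  rw [e1, e2, map_evalMat_genericMatrix, map_evalMat_genericMatrix]

end RelativeProjection

theorem exists_orbit_average {F : Type} [Field F] [IsAlgClosed F] [CharZero F] {n e : ℕ}
    {w : ∀ k : ℕ, Tensor F n k} (hw : ∀ k, e < k → w k = 0) {ι : Type} [Fintype ι]
    (q : ι → MvPolynomial (Fin n × Fin n) F) :
    ∃ (s : MvPolynomial (TupleIndex e n) F) (Y : ι → MvPolynomial (Fin n × Fin n) F),
      (∃ g ∈ orthSet F n, eval (orbitPoint e w g) s ≠ 0) ∧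
      (∀ (c : ι → F) (r : F), (∀ h ∈ orthSet F n, (∀ k, tact h k (w k) = w k) →
        ∑ i, c i * evalMat h (q i) = r) →
        ∀ g ∈ orthSet F n, ∑ i, c i * evalMat g (Y i) = eval (orbitPoint e w g) s * r) ∧
      ∀ h₀ ∈ orthSet F n, (∀ k, tact h₀ k (w k) = w k) → ∀ (i : ι) (c : ι → F),
        (∀ h ∈ orthSet F n, (∀ k, tact h k (w k) = w k) →
          evalMat (h₀.transpose * h) (q i) = ∑ j, c j * evalMat h (q j)) →
        ∀ g ∈ orthSet F n, evalMat (g * h₀) (Y i) = ∑ j, c j * evalMat g (Y j) := by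
  obtain ⟨R, _, _, _, mk, hmk, hsurj⟩ : ∃ (R : Type) (_ : CommRing R) (_ : Algebra F R)
      (_ : Algebra.FiniteType F R) (mk : MvPolynomial (Fin n × Fin n) F →ₐ[F] R),
      RingHom.ker mk = orthIdeal F n ∧ Function.Surjective mk :=
    ⟨_, _, _, inferInstance, Ideal.Quotient.mkₐ F (orthIdeal F n), Ideal.Quotient.mkₐ_ker F _,
      Ideal.Quotient.mkₐ_surjective F _⟩
  have := isReduced_of_ker_eq_orthIdeal hmk hsurj
  have := nontrivial_of_ker_eq_orthIdeal hmk
  have : IsNoetherianRing R := Algebra.FiniteType.isNoetherianRing F R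
  have : Algebra.FiniteType (orbitSubalgebra mk e w) R :=
    Algebra.FiniteType.of_restrictScalars_finiteType F _ _
  obtain ⟨s, Y, hs, hlin, htrans⟩ := exists_relative_average (S := orbitSubalgebra mk e w) F
    Subtype.val_injective fun i => evalMat (relativeMatrix mk (orbitSubalgebra mk e w)) (q i)
  obtain ⟨s', p, hp, hps⟩ := exists_orbitSubalgebra_eq s
  choose Y' hY' using fun i => hsurj (Y i)
  have hgg : ∀ {g : Matrix (Fin n) (Fin n) F}, g ∈ orthSet F n → ∀ h,
      g.transpose * (g * h) = h := fun hg h => by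
    rw [← Matrix.mul_assoc, show _ = _ from hg, Matrix.one_mul]
  refine ⟨s', Y', ?_, fun c r hc g hg => ?_, fun h₀ hh₀ hh₀w i c hc g hg => ?_⟩
  · obtain ⟨g, hg, hne⟩ := exists_evalMat_ne_zero hmk (p := p) (hp ▸ fun h => hs (Subtype.ext h))
    exact ⟨g, hg, hps g ▸ hne⟩
  · have h1 := hlin (fun i => algebraMap F R (c i)) (algebraMap F R r)
      (isNilpotent_of_orbit hmk hw fun χ g hg h hh hhw h1 h2 => by
        have h3 := algHom_evalMat_relativeMatrix χ h1 h2
        rw [hgg hg] at h3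
        have h4 : χ (algebraMap F R r ⊗ₜ 1) = r := by
          have := h1 (algebraMap F _ r)
          rw [AlgHom.commutes, AlgHom.commutes] at this
          exact this
        simp only [algebraMap_smul, map_sub, map_sum, map_smul, h3, h4, smul_eq_mul]
        rw [hc h hh hhw, sub_self])
    have h2 : mk (∑ i, C (c i) * Y' i) = mk (p * C r) := by
      rw [Algebra.smul_def, Subalgebra.algebraMap_def, hp, Algebra.algebraMap_self_apply] at h1
      simp only [← algebraMap_eq, map_sum, map_mul, AlgHom.commutes, hY']
      exact h1
    have h3 := (map_eq_map_iff_of_ker_eq_orthIdeal hmk).1 h2 g hg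
    simp only [← algebraMap_eq, map_sum, map_mul, AlgHom.commutes, hps] at h3
    exact h3
  · obtain ⟨τ, hτ⟩ := exists_right_translation (e := e) hmk hsurj hh₀ hh₀w
    have hev := evalMat_evalMat_mul (F := F) (h := h₀)
    have h1 := htrans τ.toLinearMap i (fun j => algebraMap F R (c j))
      (isNilpotent_of_orbit hmk hw fun χ g hg h hh hhw h1 h2 => by
        have h3 := algHom_evalMat_relativeMatrix χ h1 h2
        rw [hgg hg] at h3
        let T : R ⊗[orbitSubalgebra mk e w] R →ₐ[orbitSubalgebra mk e w]
            R ⊗[orbitSubalgebra mk e w] R :=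
          Algebra.TensorProduct.map τ (AlgHom.id (orbitSubalgebra mk e w) R)
        have hT : ∀ a b, T.restrictScalars F (a ⊗ₜ b) = τ a ⊗ₜ b := fun a b => rfl
        have h4 := algHom_evalMat_relativeMatrix (mk := mk) (χ.comp (T.restrictScalars F))
          (g := g * h₀) (g' := g * h) (fun p => by
            have h5 := (h1 (evalMat (genericMatrix F n * h₀.map (algebraMap F _)) p)).trans
              (hev g p)
            rw [← hτ] at h5
            rw [AlgHom.comp_apply, hT]
            exact h5) (fun p => by
            rw [AlgHom.comp_apply, hT, map_one]
            exact h2 p) (q i)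
        rw [Matrix.transpose_mul, Matrix.mul_assoc, hgg hg, hc h hh hhw] at h4
        simp only [algebraMap_smul, map_sub, map_sum, map_smul, h3, smul_eq_mul]
        rw [← h4, sub_eq_zero]
        rfl)
    have h2 : mk (evalMat (genericMatrix F n * h₀.map (algebraMap F _)) (Y' i))
        = mk (∑ j, C (c j) * Y' j) := by
      rw [← hτ]
      simp only [← algebraMap_eq, map_sum, map_mul, AlgHom.commutes, hY']
      exact h1
    have h3 := (map_eq_map_iff_of_ker_eq_orthIdeal hmk).1 h2 g hg
    rw [hev] at h3
    simp only [← algebraMap_eq, map_sum, map_mul, AlgHom.commutes] at h3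
    exact h3

section Invariants

variable {F : Type} [Field F] {n : ℕ}

/-- The coordinates of the translate of a tensor by the generic matrix. -/
noncomputable def tactPoly {k : ℕ} (a : Tensor F n k) (φ : Fin k → Fin n) :
    MvPolynomial (Fin n × Fin n) F :=
  ∑ ψ, (∏ i, X (φ i, ψ i)) * C (a ψ)

theorem evalMat_tactPoly {k : ℕ} (a : Tensor F n k) (φ : Fin k → Fin n)
    (g : Matrix (Fin n) (Fin n) F) : evalMat g (tactPoly a φ) = tact g k a φ := by
  simp [tactPoly, evalMat, tact_apply]

theorem tactPoly_tmul {k l : ℕ} (a : Tensor F n k) (b : Tensor F n l) (φ : Fin k → Fin n)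
    (ψ : Fin l → Fin n) : tactPoly (tmul a b) (Fin.append φ ψ) = tactPoly a φ * tactPoly b ψ := by
  rw [tactPoly, tactPoly, tactPoly, Finset.sum_mul_sum, ← Finset.sum_product',
    ← (Fin.appendEquiv k l).sum_comp]
  refine Finset.sum_congr rfl fun χ _ => ?_
  simp [Fin.appendEquiv, tmul, Fin.prod_univ_add]
  ring

theorem exists_eq_orbit_eval [IsAlgClosed F] [CharZero F] {e : ℕ} {w : ∀ k : ℕ, Tensor F n k}
    (hw : ∀ k, e < k → w k = 0) (horb : IsZarClosed (tensorTupleOrbit e w)) {ι : Type} [Fintype ι]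
    (f : ι → MvPolynomial (Fin n × Fin n) F)
    (hf : ∀ i, ∀ g ∈ orthSet F n, ∀ h ∈ orthSet F n, (∀ k, tact h k (w k) = w k) →
      evalMat (g * h) (f i) = evalMat g (f i))
    (hspan : ∀ g₀ ∈ orthSet F n, ∀ i, ∃ c : ι → F, ∀ g ∈ orthSet F n,
      evalMat (g₀ * g) (f i) = ∑ j, c j * evalMat g (f j)) (i : ι) :
    ∃ t : MvPolynomial (TupleIndex e n) F, ∀ g ∈ orthSet F n,
      evalMat g (f i) = eval (orbitPoint e w g) t := by
  let I : Ideal (MvPolynomial (TupleIndex e n) F) :=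
    { carrier := {s | ∀ i, ∃ t : MvPolynomial (TupleIndex e n) F, ∀ g ∈ orthSet F n,
        eval (orbitPoint e w g) s * evalMat g (f i) = eval (orbitPoint e w g) t}
      add_mem' := fun {s s'} hs hs' i => by
        obtain ⟨t, ht⟩ := hs i
        obtain ⟨t', ht'⟩ := hs' i
        exact ⟨t + t', fun g hg => by rw [map_add, map_add, add_mul, ht g hg, ht' g hg]⟩
      zero_mem' := fun i => ⟨0, fun g _ => by rw [map_zero, zero_mul]⟩
      smul_mem' := fun c s hs i => by
        obtain ⟨t, ht⟩ := hs i
        exact ⟨c * t, fun g hg => by rw [smul_eq_mul, map_mul, map_mul, mul_assoc, ht g hg]⟩ }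
  obtain ⟨s, ⟨g₁, hg₁, hne⟩, hs⟩ := exists_orbit_denominator hw f hf
  have h1 : (1 : MvPolynomial (TupleIndex e n) F) ∈ I := by
    refine one_mem_of_translate e w horb (fun p hp i => ⟨0, fun g hg => ?_⟩)
      (fun p hp g₀ hg₀ p' hp' i => ?_) hs hg₁ hne
    · rw [hp g hg, zero_mul, map_zero]
    · have hg₀' := transpose_mem_orthSet hg₀
      choose t ht using hp
      choose t' ht' using fun j => exists_translate e w (t j) g₀
      obtain ⟨c, hc⟩ := hspan g₀.transpose hg₀' i
      refine ⟨∑ j, C (c j) * t' j, fun g hg => ?_⟩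
      have h2 := hc (g₀ * g) (mul_mem_orthSet hg₀ hg)
      rw [← Matrix.mul_assoc, show g₀.transpose * g₀ = 1 from hg₀, Matrix.one_mul] at h2
      rw [h2, hp' g hg, Finset.mul_sum, map_sum]
      refine Finset.sum_congr rfl fun j _ => ?_
      rw [mul_left_comm, ht j _ (mul_mem_orthSet hg₀ hg), map_mul, eval_C, ht']
  obtain ⟨t, ht⟩ := h1 i
  exact ⟨t, fun g hg => by rw [← ht g hg, map_one, one_mul]⟩

namespace IsContractionClosed

variable {A : ∀ k : ℕ, Submodule F (Tensor F n k)}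

/-- The span of the matrix coefficients of the tensors in `A`. -/
noncomputable def coeffSpan (A : ∀ k : ℕ, Submodule F (Tensor F n k)) :
    Submodule F (MvPolynomial (Fin n × Fin n) F) :=
  Submodule.span F {f | ∃ (k : ℕ) (a : Tensor F n k) (φ : Fin k → Fin n), a ∈ A k ∧ f = tactPoly a φ}

theorem aeval_orbitPoly_mem_coeffSpan (hA : IsContractionClosed A) {e : ℕ}
    {w : ∀ k : ℕ, Tensor F n k} (hwA : ∀ k, w k ∈ A k) (t : MvPolynomial (TupleIndex e n) F) :
    aeval (orbitPoly e w) t ∈ coeffSpan A := by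
  induction t using MvPolynomial.induction_on with
  | C c =>
    rw [← algebraMap_eq, AlgHom.commutes, Algebra.algebraMap_eq_smul_one]
    refine Submodule.smul_mem _ _ (Submodule.subset_span ⟨0, _, Fin.elim0, hA.one_mem, ?_⟩)
    simp [tactPoly]
  | add p q hp hq =>
    rw [map_add]
    exact Submodule.add_mem _ hp hq
  | mul_X p q hp =>
    rw [map_mul, aeval_X]
    generalize aeval (orbitPoly e w) p = f at hp
    induction hp using Submodule.span_induction with
    | mem x hx =>
      obtain ⟨k, a, φ, ha, rfl⟩ := hx
      exact Submodule.subset_span ⟨_, _, _, hA.mul_mem _ _ _ _ ha (hwA q.1),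
        (tactPoly_tmul a (w q.1) φ q.2).symm⟩
    | zero => simp
    | add x y _ _ hx hy =>
      rw [add_mul]
      exact Submodule.add_mem _ hx hy
    | smul c x _ hx =>
      rw [smul_mul_assoc]
      exact Submodule.smul_mem _ _ hx

theorem haar_prod_X_mul_mem [CharZero F] (hA : IsContractionClosed A) {k : ℕ} (ψ : Fin k → Fin n)
    {f : MvPolynomial (Fin n × Fin n) F} (hf : f ∈ coeffSpan A) :
    (fun φ => haar F n ((∏ i, X (ψ i, φ i)) * f) : Tensor F n k) ∈ A k := by
  induction hf using Submodule.span_induction with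
  | mem x hx =>
    obtain ⟨d, u, I, hu, rfl⟩ := hx
    have h := hA.indexed_pairing (hA.haar_prod_X_mem (Sum.elim ψ I)) (hA.mem_indexed_fin hu)
    convert mem_of_mem_indexed_fin h using 1
    funext φ
    rw [tactPoly, Finset.mul_sum, map_sum]
    refine Finset.sum_congr rfl fun J _ => ?_
    rw [← mul_assoc, mul_comm _ (C _), ← smul_eq_C_mul, map_smul, smul_eq_mul, mul_comm]
    simp [Fintype.prod_sum_type]
  | zero =>
    simp only [mul_zero, map_zero]
    exact Submodule.zero_mem _
  | add x y _ _ hx hy =>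
    simp only [mul_add, map_add]
    exact Submodule.add_mem _ hx hy
  | smul c x _ hx =>
    simp only [mul_smul_comm, map_smul]
    exact Submodule.smul_mem _ c hx

theorem mem_of_tact_eq [IsAlgClosed F] [CharZero F] (hA : IsContractionClosed A) {e : ℕ}
    {w : ∀ k : ℕ, Tensor F n k} (hwA : ∀ k, w k ∈ A k) (hw : ∀ k, e < k → w k = 0)
    (horb : IsZarClosed (tensorTupleOrbit e w)) {k : ℕ} {a : Tensor F n k}
    (ha : ∀ h ∈ orthSet F n, (∀ k, tact h k (w k) = w k) → tact h k a = a) : a ∈ A k := by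
  choose t ht using exists_eq_orbit_eval hw horb (tactPoly a)
    (fun φ g _ h hh hhw => by
      rw [evalMat_tactPoly, evalMat_tactPoly, tact_mul, ha h hh hhw])
    (fun g₀ _ φ => ⟨fun ψ => ∏ i, g₀ (φ i) (ψ i), fun g _ => by
      simp only [evalMat_tactPoly]
      rw [tact_mul, tact_apply]⟩)
  have hmem : ∀ φ, C (a φ) - ∑ ψ, (∏ i, X (ψ i, φ i)) * aeval (orbitPoly e w) (t ψ)
      ∈ orthIdeal F n := by
    refine fun φ => mem_orthIdeal_of_forall_evalMat_eq_zero fun g hg => ?_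
    have h1 : ∀ ψ, evalMat g (aeval (orbitPoly e w) (t ψ)) = tact g k a ψ := fun ψ => by
      rw [← evalMat_tactPoly, ht ψ g hg, ← AlgHom.comp_apply, comp_aeval, ← aeval_eq_eval]
      simp only [evalMat_orbitPoly]
    have h2 : tact g.transpose k (tact g k a) φ = a φ := by
      rw [← tact_mul, show g.transpose * g = 1 from hg, tact_one]
    rw [tact_apply] at h2
    simp only [map_sub, map_sum, map_mul, map_prod, h1, ← h2]
    simp [evalMat]
  have h3 : a = ∑ ψ, fun φ => haar F n ((∏ i, X (ψ i, φ i)) * aeval (orbitPoly e w) (t ψ)) := by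
    funext φ
    have h4 := haar_eq_zero_of_mem_orthIdeal (hmem φ)
    rw [map_sub, sub_eq_zero, map_sum, ← mul_one (C (a φ)), ← smul_eq_C_mul, map_smul, haar_one,
      smul_eq_mul, mul_one] at h4
    rw [h4, Finset.sum_apply]
  rw [h3]
  exact Submodule.sum_mem _ fun ψ _ =>
    hA.haar_prod_X_mul_mem ψ (hA.aeval_orbitPoly_mem_coeffSpan hwA (t ψ))

end IsContractionClosed

end Invariants

section Reductivity

variable {F : Type} [Field F] {n : ℕ}

theorem evalMat_evalMat_left_mul (g h : Matrix (Fin n) (Fin n) F)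
    (p : MvPolynomial (Fin n × Fin n) F) :
    evalMat g (evalMat (h.map (algebraMap F _) * genericMatrix F n) p) = evalMat (h * g) p := by
  rw [evalMat_comp_evalMat, Matrix.map_mul, map_evalMat_genericMatrix, Matrix.map_map]
  have : (⇑(evalMat (F := F) g) ∘ ⇑(algebraMap F (MvPolynomial (Fin n × Fin n) F))) = id :=
    funext (evalMat (F := F) g).commutes
  rw [this, Matrix.map_id]

theorem evalMat_aeval_orbitPoly {e : ℕ} {w : ∀ k : ℕ, Tensor F n k}
    (g : Matrix (Fin n) (Fin n) F) (t : MvPolynomial (TupleIndex e n) F) :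
    evalMat g (aeval (orbitPoly e w) t) = eval (orbitPoint e w g) t := by
  rw [← AlgHom.comp_apply, comp_aeval, ← aeval_eq_eval]
  simp only [evalMat_orbitPoly]

theorem orbitPoint_mul {e : ℕ} {w : ∀ k : ℕ, Tensor F n k} (g : Matrix (Fin n) (Fin n) F)
    {h : Matrix (Fin n) (Fin n) F} (hhw : ∀ k, tact h k (w k) = w k) :
    orbitPoint e w (g * h) = orbitPoint e w g := by
  funext q
  rw [orbitPoint, tact_mul, hhw, orbitPoint]

/-- Averages over the stabilizer of a point with closed orbit. -/
theorem exists_stabilizer_average [IsAlgClosed F] [CharZero F] {e : ℕ} {w : ∀ k : ℕ, Tensor F n k}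
    (hw : ∀ k, e < k → w k = 0) (horb : IsZarClosed (tensorTupleOrbit e w)) {ι : Type} [Fintype ι]
    (q : ι → MvPolynomial (Fin n × Fin n) F) :
    ∃ Y : ι → MvPolynomial (Fin n × Fin n) F,
      (∀ (c : ι → F) (r : F), (∀ h ∈ orthSet F n, (∀ k, tact h k (w k) = w k) →
        ∑ i, c i * evalMat h (q i) = r) →
        ∀ g ∈ orthSet F n, ∑ i, c i * evalMat g (Y i) = r) ∧
      ∀ h₀ ∈ orthSet F n, (∀ k, tact h₀ k (w k) = w k) → ∀ (i : ι) (c : ι → F),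
        (∀ h ∈ orthSet F n, (∀ k, tact h k (w k) = w k) →
          evalMat (h₀.transpose * h) (q i) = ∑ j, c j * evalMat h (q j)) →
        ∀ g ∈ orthSet F n, evalMat (g * h₀) (Y i) = ∑ j, c j * evalMat g (Y j) := by
  let I : Ideal (MvPolynomial (TupleIndex e n) F) :=
    { carrier := {s | ∃ Y : ι → MvPolynomial (Fin n × Fin n) F,
        (∀ (c : ι → F) (r : F), (∀ h ∈ orthSet F n, (∀ k, tact h k (w k) = w k) →
          ∑ i, c i * evalMat h (q i) = r) →
          ∀ g ∈ orthSet F n, ∑ i, c i * evalMat g (Y i) = eval (orbitPoint e w g) s * r) ∧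
        ∀ h₀ ∈ orthSet F n, (∀ k, tact h₀ k (w k) = w k) → ∀ (i : ι) (c : ι → F),
          (∀ h ∈ orthSet F n, (∀ k, tact h k (w k) = w k) →
            evalMat (h₀.transpose * h) (q i) = ∑ j, c j * evalMat h (q j)) →
          ∀ g ∈ orthSet F n, evalMat (g * h₀) (Y i) = ∑ j, c j * evalMat g (Y j)}
      add_mem' := by
        rintro s s' ⟨Y, hY1, hY2⟩ ⟨Y', hY1', hY2'⟩
        refine ⟨fun i => Y i + Y' i, fun c r hc g hg => ?_, fun h₀ hh₀ hh₀w i c hc g hg => ?_⟩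
        · simp only [map_add, mul_add, add_mul, Finset.sum_add_distrib, hY1 c r hc g hg,
            hY1' c r hc g hg]
        · simp only [map_add, mul_add, Finset.sum_add_distrib, hY2 h₀ hh₀ hh₀w i c hc g hg,
            hY2' h₀ hh₀ hh₀w i c hc g hg]
      zero_mem' := ⟨0, by simp⟩
      smul_mem' := by
        rintro t s ⟨Y, hY1, hY2⟩
        refine ⟨fun i => aeval (orbitPoly e w) t * Y i, fun c r hc g hg => ?_,
          fun h₀ hh₀ hh₀w i c hc g hg => ?_⟩
        · simp only [map_mul, smul_eq_mul, mul_left_comm (c _), ← Finset.mul_sum, hY1 c r hc g hg,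
            evalMat_aeval_orbitPoly, mul_assoc]
        · simp only [map_mul, mul_left_comm (c _), ← Finset.mul_sum, hY2 h₀ hh₀ hh₀w i c hc g hg,
            evalMat_aeval_orbitPoly, orbitPoint_mul g hh₀w] }
  obtain ⟨s, Y, ⟨g₁, hg₁, hne⟩, hs⟩ := exists_orbit_average hw q
  have h1 : (1 : MvPolynomial (TupleIndex e n) F) ∈ I := by
    refine one_mem_of_translate e w horb (fun p hp => ⟨0, fun c r hc g hg => ?_, by simp⟩)
      ?_ (p := s) ⟨Y, hs⟩ hg₁ hne
    · simp [hp g hg]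
    · rintro p ⟨Y, hY1, hY2⟩ g₀ hg₀ p' hp'
      refine ⟨fun i => evalMat (g₀.map (algebraMap F _) * genericMatrix F n) (Y i),
        fun c r hc g hg => ?_, fun h₀ hh₀ hh₀w i c hc g hg => ?_⟩
      · simp only [evalMat_evalMat_left_mul]
        rw [hY1 c r hc _ (mul_mem_orthSet hg₀ hg), hp' g hg]
      · simp only [evalMat_evalMat_left_mul]
        rw [← Matrix.mul_assoc, hY2 h₀ hh₀ hh₀w i c hc _ (mul_mem_orthSet hg₀ hg)]
  obtain ⟨Y, hY1, hY2⟩ := h1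
  exact ⟨Y, fun c r hc g hg => by rw [hY1 c r hc g hg, map_one, one_mul], hY2⟩

theorem IsContractionClosed.haar_eq_of_forall_evalMat_eq [IsAlgClosed F] [CharZero F]
    {f : MvPolynomial (Fin n × Fin n) F} {r : F} (h : ∀ g ∈ orthSet F n, evalMat g f = r) :
    haar F n f = r := by
  have h1 : f - C r ∈ orthIdeal F n := mem_orthIdeal_of_forall_evalMat_eq_zero fun g hg => by
    rw [map_sub, h g hg, ← algebraMap_eq, AlgHom.commutes, Algebra.algebraMap_self_apply, sub_self]
  have h2 := IsContractionClosed.haar_eq_zero_of_mem_orthIdeal h1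
  rwa [map_sub, sub_eq_zero, ← mul_one (C r), ← smul_eq_C_mul, map_smul,
    IsContractionClosed.haar_one, smul_eq_mul, mul_one] at h2

theorem IsContractionClosed.isLinRed_setStab [IsAlgClosed F] [CharZero F]
    {A : ∀ k : ℕ, Submodule F (Tensor F n k)} (hA : IsContractionClosed A) {e : ℕ}
    {w : ∀ k : ℕ, Tensor F n k} (hw : ∀ k, e < k → w k = 0)
    (hstab : setStab A = {g | g ∈ orthSet F n ∧ ∀ k, tact g k (w k) = w k})
    (horb : IsZarClosed (tensorTupleOrbit e w)) : IsLinRed (setStab A) := by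
  intro m ρ hpoly hmul hone W hW
  have hmem : ∀ {h}, h ∈ orthSet F n → (∀ k, tact h k (w k) = w k) → h ∈ setStab A :=
    fun hh hhw => by rw [hstab]; exact ⟨hh, hhw⟩
  choose P hP using hpoly
  have hρ : ∀ g, (Matrix.of P).map (evalMat g) = ρ g := fun g => by
    ext a b
    rw [hP a b g]
    rfl
  obtain ⟨f, hf⟩ := LinearMap.exists_leftInverse_of_injective W.subtype W.ker_subtype
  set π : Matrix (Fin m) (Fin m) F := LinearMap.toMatrix' (W.subtype ∘ₗ f) with hπ
  have hπmem : ∀ v, π.mulVec v ∈ W := fun v => by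
    rw [hπ, LinearMap.toMatrix'_mulVec]
    exact (f v).2
  have hπid : ∀ v ∈ W, π.mulVec v = v := fun v hv => by
    rw [hπ, LinearMap.toMatrix'_mulVec]
    exact congrArg Subtype.val (LinearMap.congr_fun hf ⟨v, hv⟩)
  let M : Matrix (Fin n) (Fin n) F → Matrix (Fin m) (Fin m) F := fun h => ρ h * π * ρ h.transpose
  let Q : Matrix (Fin m) (Fin m) (MvPolynomial (Fin n × Fin n) F) :=
    Matrix.of P * π.map (algebraMap F _) *
      (Matrix.of P).map (evalMat (genericMatrix F n).transpose)
  let q : Fin m × Fin m → MvPolynomial (Fin n × Fin n) F := fun a => Q a.1 a.2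
  have hq : ∀ h a b, evalMat h (q (a, b)) = M h a b := by
    intro h a b
    have : Q.map (evalMat (F := F) h) = M h := by
      have h1 : (⇑(evalMat (F := F) h) ∘ ⇑(algebraMap F (MvPolynomial (Fin n × Fin n) F))) = id :=
        funext (evalMat (F := F) h).commutes
      have h2 : (⇑(evalMat (F := F) h) ∘ ⇑(evalMat (genericMatrix F n).transpose))
          = evalMat h.transpose := funext fun p => by
        rw [Function.comp_apply, evalMat_comp_evalMat, Matrix.transpose_map,
          map_evalMat_genericMatrix]
      rw [Matrix.map_mul, Matrix.map_mul, Matrix.map_map, Matrix.map_map, h1, h2, hρ, hρ,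
        Matrix.map_id]
    exact congrFun (congrFun this a) b
  obtain ⟨Y, hY1, hY2⟩ := exists_stabilizer_average hw horb q
  have hinv : ∀ h ∈ setStab A, ρ h * ρ h.transpose = 1 := fun h hh => by
    rw [← hmul h hh _ (transpose_mem_setStab hh), mul_eq_one_comm.1 (show h.transpose * h = 1 from
      hh.1), hone]
  let Z : Matrix (Fin m) (Fin m) F := .of fun a b => haar F n (Y (a, b))
  have hZlin : ∀ (θ u : Fin m → F) (r : F), (∀ h ∈ setStab A, θ ⬝ᵥ (M h).mulVec u = r) →
      θ ⬝ᵥ Z.mulVec u = r := by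
    intro θ u r hr
    have hsum : ∀ N : Matrix (Fin m) (Fin m) F,
        θ ⬝ᵥ N.mulVec u = ∑ a : Fin m × Fin m, θ a.1 * u a.2 * N a.1 a.2 := fun N => by
      simp only [dotProduct, Matrix.mulVec, Finset.mul_sum, Fintype.sum_prod_type]
      exact Finset.sum_congr rfl fun a _ => Finset.sum_congr rfl fun b _ => by ring
    have h1 := hY1 (fun a => θ a.1 * u a.2) r fun h hh hhw => by
      rw [← hr h (hmem hh hhw), hsum]
      exact Finset.sum_congr rfl fun a _ => by rw [← hq]
    have h2 := haar_eq_of_forall_evalMat_eq (f := ∑ a, C (θ a.1 * u a.2) * Y a) (r := r)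
      fun g hg => by
        rw [← h1 g hg]
        simp only [← algebraMap_eq, map_sum, map_mul, AlgHom.commutes]
        simp
    rw [hsum, ← h2, map_sum]
    refine Finset.sum_congr rfl fun a _ => ?_
    rw [← smul_eq_C_mul, map_smul, smul_eq_mul]
    rfl
  have hZcomm : ∀ h ∈ setStab A, Z = ρ h.transpose * Z * ρ h := by
    intro h hh
    have hht := transpose_mem_setStab hh
    have hentry : ∀ (N : Matrix (Fin m) (Fin m) F) a b, (ρ h.transpose * N * ρ h) a b
        = ∑ p : Fin m × Fin m, ρ h.transpose a p.1 * ρ h p.2 b * N p.1 p.2 := fun N a b => by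
      simp only [Matrix.mul_apply, Finset.sum_mul, Fintype.sum_prod_type]
      rw [Finset.sum_comm]
      exact Finset.sum_congr rfl fun a _ => Finset.sum_congr rfl fun b _ => by ring
    ext a b
    have h1 := hY2 h hh.1 (hstab.subset hh).2 (a, b)
      (fun p => ρ h.transpose a p.1 * ρ h p.2 b) fun h' hh' hhw' => by
        have h'm := hmem hh' hhw'
        rw [hq]
        have : M (h.transpose * h') = ρ h.transpose * M h' * ρ h := by
          simp only [M]
          rw [Matrix.transpose_mul, Matrix.transpose_transpose, hmul _ hht _ h'm,
            hmul _ (transpose_mem_setStab h'm) _ hh]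
          simp only [Matrix.mul_assoc]
        rw [this, hentry]
        exact Finset.sum_congr rfl fun p _ => by rw [← hq]
    have h2 : evalMat (genericMatrix F n * h.map (algebraMap F _)) (Y (a, b)) -
        ∑ p : Fin m × Fin m, C (ρ h.transpose a p.1 * ρ h p.2 b) * Y p ∈ orthIdeal F n :=
      mem_orthIdeal_of_forall_evalMat_eq_zero fun g hg => by
        rw [map_sub, evalMat_evalMat_mul, h1 g hg, sub_eq_zero]
        simp only [← algebraMap_eq, map_sum, map_mul, AlgHom.commutes]
        simp
    have h3 := IsContractionClosed.haar_eq_zero_of_mem_orthIdeal h2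
    rw [map_sub, sub_eq_zero, hA.haar_mul_right hht.2, map_sum] at h3
    rw [hentry]
    refine h3.trans (Finset.sum_congr rfl fun p _ => ?_)
    rw [← smul_eq_C_mul, map_smul, smul_eq_mul]
    rfl
  have hZid : ∀ v ∈ W, Z.mulVec v = v := by
    intro v hv
    refine dotProduct_eq _ _ fun θ => ?_
    rw [dotProduct_comm, dotProduct_comm v]
    refine hZlin θ v _ fun h hh => ?_
    congr 1
    simp only [M]
    rw [← Matrix.mulVec_mulVec, ← Matrix.mulVec_mulVec,
      hπid _ (hW _ (transpose_mem_setStab hh) v hv), Matrix.mulVec_mulVec, hinv h hh,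
      Matrix.one_mulVec]
  have hZmem : ∀ u, Z.mulVec u ∈ W := by
    intro u
    by_contra hu
    obtain ⟨θ, hθ, hθW⟩ := Submodule.exists_dual_map_eq_bot_of_notMem hu inferInstance
    have hdot : ∀ v, θ v = (fun i => θ (Pi.single i 1)) ⬝ᵥ v := fun v => by
      conv_lhs => rw [pi_eq_sum_univ' v]
      simp [dotProduct, mul_comm]
    refine hθ ?_
    rw [hdot]
    refine hZlin _ u 0 fun h hh => ?_
    rw [← hdot]
    have : (M h).mulVec u ∈ W := by
      simp only [M]
      rw [← Matrix.mulVec_mulVec, ← Matrix.mulVec_mulVec]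
      exact hW h hh _ (hπmem _)
    exact (Submodule.mem_bot F).1 (hθW ▸ Submodule.mem_map_of_mem this)
  refine ⟨LinearMap.ker Z.mulVecLin, ⟨?_, ?_⟩, fun h hh v hv => ?_⟩
  · rw [Submodule.disjoint_def]
    intro v hv hv'
    rw [← hZid v hv]
    exact hv'
  · rw [codisjoint_iff, eq_top_iff]
    intro v _
    rw [← add_sub_cancel (Z.mulVec v) v]
    refine Submodule.add_mem_sup (hZmem v) ?_
    rw [LinearMap.mem_ker, map_sub, Matrix.mulVecLin_apply, Matrix.mulVecLin_apply,
      hZid _ (hZmem v), sub_self]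
  · have hv' : Z.mulVec v = 0 := hv
    rw [LinearMap.mem_ker, Matrix.mulVecLin_apply, Matrix.mulVec_mulVec]
    have h1 : Z * ρ h = ρ h * Z := by
      conv_rhs => rw [hZcomm h hh]
      rw [← Matrix.mul_assoc, ← Matrix.mul_assoc, hinv h hh, Matrix.one_mul]
    rw [h1, ← Matrix.mulVec_mulVec, hv', Matrix.mulVec_zero]

end Reductivity

/-- **Theorem 7** (algebras of invariant tensors).  If `A ⊆ T(V)` is a graded
contraction-closed subalgebra containing `∑ᵢ eᵢ ⊗ eᵢ`, and the pointwise
stabilizer of `A` equals the stabilizer of some `w ∈ A` (supported in degrees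
`≤ e`) whose `O_n`-orbit is Zariski closed, then `A = T(V)^{Stab(A)}` and
`Stab(A)` is (linearly) reductive. -/
theorem graded_contraction_closed_algebra_invariants (𝔽 : Type) [Field 𝔽]
    [IsAlgClosed 𝔽] [CharZero 𝔽] (n : ℕ)
    (A : ∀ k : ℕ, Submodule 𝔽 (Tensor 𝔽 n k))
    (hone : (fun _ => 1 : Tensor 𝔽 n 0) ∈ A 0)
    (hmul : ∀ (k l : ℕ) (a : Tensor 𝔽 n k) (b : Tensor 𝔽 n l),
      a ∈ A k → b ∈ A l → tmul a b ∈ A (k + l))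
    (hcontr : ∀ (m : ℕ) (i j : Fin (m + 2)), i < j →
      ∀ a ∈ A (m + 2), tcontract i j a ∈ A m)
    (hdiag : (fun φ => if φ 0 = φ 1 then 1 else 0 : Tensor 𝔽 n 2) ∈ A 2)
    (e : ℕ) (w : ∀ k : ℕ, Tensor 𝔽 n k)
    (hwA : ∀ k, w k ∈ A k) (hwsupp : ∀ k, e < k → w k = 0)
    (hstab : setStab A = {g | g ∈ orthSet 𝔽 n ∧ ∀ k, tact g k (w k) = w k})
    (horb : IsZarClosed (tensorTupleOrbit e w)) :
    (∀ k, A k = invSub (setStab A) k) ∧ IsLinRed (setStab A) := by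
  have hA : IsContractionClosed A := ⟨hone, hmul, hcontr, hdiag⟩
  refine ⟨fun k => le_antisymm (fun a ha g hg => hg.2 k a ha) fun a ha => ?_,
    hA.isLinRed_setStab hwsupp hstab horb⟩
  exact hA.mem_of_tact_eq hwA hwsupp horb fun h hh hhw => ha h (by rw [hstab]; exact ⟨hh, hhw⟩)
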